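/- Let n ∈ ℤ, n ≥ 2, let T_n be the times-n map on the circle 𝕋, let S ⊆ 𝕋 be a finite set, let t₀ > 0 and g = diag(e^{t₀}, e^{−t₀}) ∈ SL₂(ℝ), and let 𝒢 be the Gauss map. Then the set {s ∈ ℝ : the closure of 𝒪^ℕ_{T_n}([s]) in 𝕋 is disjoint from S, and the forward 𝒢-orbit {𝒢ᵏ(frac(s)) : k ∈ ℕ} is dense in [0,1)} has Hausdorff dimension 1. -/

import Mathlib

open MeasureTheory Matrix Filter Set
open scoped ENNReal

noncomputable section

/-- Topology on special linear groups (induced from the matrix topology). -/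
instance (n : Type*) [DecidableEq n] [Fintype n] (R : Type*) [CommRing R] [TopologicalSpace R] :
    TopologicalSpace (Matrix.SpecialLinearGroup n R) :=
  TopologicalSpace.induced (fun A => (A : Matrix n n R)) inferInstance

abbrev SL2R := Matrix.SpecialLinearGroup (Fin 2) ℝ
abbrev SL2Z := Matrix.SpecialLinearGroup (Fin 2) ℤ

/-- The image of `SL₂(ℤ)` in `SL₂(ℝ)`. -/
def SL2Zsub : Subgroup SL2R :=
  MonoidHom.range (Matrix.SpecialLinearGroup.map (n := Fin 2) (Int.castRingHom ℝ))

/-- The space of unimodular lattices `X₂ = SL₂(ℝ)/SL₂(ℤ)`. -/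
abbrev X2 := SL2R ⧸ SL2Zsub

/-- `h₂(s)` is the class of the matrix `[[1, s], [0, 1]]` in `X₂`. -/
def h2 (s : ℝ) : X2 :=
  QuotientGroup.mk ⟨!![(1:ℝ), s; 0, 1], by simp [Matrix.det_fin_two_of]⟩

/-- The diagonal matrix `diag(e^t, e^{-t}) ∈ SL₂(ℝ)`. -/
def g2 (t : ℝ) : SL2R :=
  ⟨!![Real.exp t, 0; 0, Real.exp (-t)], by
    simp [Matrix.det_fin_two_of, ← Real.exp_add]⟩

/-- The circle `𝕋 = ℝ/ℤ`. -/
abbrev Circ := UnitAddCircle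

/-- The Gauss map `𝒢(x) = frac(1/x)` (with `𝒢(0) = 0`, since `(0:ℝ)⁻¹ = 0`). -/
def gaussMap (x : ℝ) : ℝ := Int.fract x⁻¹

theorem gaussMap_iterate_of_moebius (n : ℕ) : ∀ (p p' q q' : ℤ) (x y : ℝ), q.toNat = n → 1 ≤ q →
    0 ≤ q' → q' ≤ q → (p * q' - p' * q = 1 ∨ p * q' - p' * q = -1) → 2 < y →
    x * (q * y + q') = p * y + p' → ∃ k : ℕ, gaussMap^[k] (Int.fract x) = Int.fract y := by
  induction n using Nat.strong_induction_on with
  | _ n ih =>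
  intro p p' q q' x y hn hq hq0 hq1 hdet hy hx
  rcases hq.eq_or_lt with rfl | hq2
  · have hY0 : (0:ℝ) ≤ q' := by exact_mod_cast hq0
    have hYf : ∀ m : ℤ, Int.fract (y + q' + m) = Int.fract y := fun m => by
      rw [Int.fract_add_intCast, Int.fract_add_intCast]
    set Y : ℝ := y + q' with hY
    have hY2 : 2 < Y := by linarith
    rcases hdet with h | h
    · have hp : (p' : ℝ) = p * q' - 1 := by
        have : p' = p * q' - 1 := by linarith
        rw [this]; push_cast; ring
      have hxe : x = (1 - 1 / Y) + ((p - 1 : ℤ) : ℝ) := by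
        have : x * Y = p * Y - 1 := by
          rw [hp] at hx; push_cast at hx; rw [hY]; linarith
        field_simp
        push_cast
        linarith
      have hf : Int.fract x = 1 - 1 / Y := by
        rw [hxe, Int.fract_add_intCast, Int.fract_eq_self]
        refine ⟨?_, ?_⟩
        · rw [sub_nonneg, div_le_one (by linarith)]; linarith
        · have : 0 < 1 / Y := by positivity
          linarith
      refine ⟨2, ?_⟩
      have h1 : gaussMap (1 - 1 / Y) = 1 / (Y - 1) := by
        have : (1 - 1 / Y)⁻¹ = 1 / (Y - 1) + ((1 : ℤ) : ℝ) := by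
          have h1 : Y - 1 ≠ 0 := by linarith
          have h2 : Y ≠ 0 := by linarith
          have h3 : 1 - 1 / Y = (Y - 1) / Y := by field_simp
          rw [h3, inv_div]; field_simp; push_cast; ring
        rw [gaussMap, this, Int.fract_add_intCast, Int.fract_eq_self]
        refine ⟨by apply div_nonneg <;> linarith, ?_⟩
        rw [div_lt_one] <;> linarith
      rw [hf, Function.iterate_succ_apply, Function.iterate_one, h1, gaussMap, one_div, inv_inv]
      have := hYf (-1)
      push_cast at this
      rw [← this]; rfl
    · have hp : (p' : ℝ) = p * q' + 1 := by
        have : p' = p * q' + 1 := by linarith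
        rw [this]; push_cast; ring
      have hxe : x = 1 / Y + (p : ℝ) := by
        have : x * Y = p * Y + 1 := by
          rw [hp] at hx; push_cast at hx; rw [hY]; linarith
        field_simp
        linarith
      have hf : Int.fract x = 1 / Y := by
        rw [hxe, Int.fract_add_intCast, Int.fract_eq_self]
        refine ⟨by positivity, ?_⟩
        rw [div_lt_one] <;> linarith
      refine ⟨1, ?_⟩
      rw [hf, Function.iterate_one, gaussMap, one_div, inv_inv]
      simpa using hYf 0
  · have hq2' : 2 ≤ q := hq2
    set a := p / q with ha
    set r := p % q with hr
    have hpa : p = q * a + r := (Int.mul_ediv_add_emod p q).symm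
    have hr0 : 0 ≤ r := Int.emod_nonneg _ (by omega)
    have hrq : r < q := Int.emod_lt_of_pos _ (by omega)
    set r' := p' - a * q' with hr'
    have hdet' : q * r' - q' * r = -(p * q' - p' * q) := by rw [hr', hpa]; ring
    have hd1 : q * r' - q' * r ≤ 1 := by rcases hdet with h | h <;> omega
    have hd2 : -1 ≤ q * r' - q' * r := by rcases hdet with h | h <;> omega
    have hrpos : 0 < r := by
      rcases hr0.eq_or_lt with h | h
      · exfalso
        rw [← h] at hd1 hd2 hdet'
        rcases hdet with h' | h'
        · have : q * (-r') = 1 := by linarith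
          have := Int.eq_one_or_neg_one_of_mul_eq_one this
          omega
        · have : q * (r') = 1 := by linarith
          have := Int.eq_one_or_neg_one_of_mul_eq_one this
          omega
      · exact h
    have hq'pos : 0 < q' := by
      rcases hq0.eq_or_lt with h | h
      · exfalso
        rw [← h] at hd1 hd2 hdet
        rcases hdet with h' | h'
        · have : q * (-p') = 1 := by linarith
          have := Int.eq_one_or_neg_one_of_mul_eq_one this
          omega
        · have : q * (p') = 1 := by linarith
          have := Int.eq_one_or_neg_one_of_mul_eq_one this
          omega
      · exact h
    have hr'0 : 0 ≤ r' := by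
      by_contra hc
      have : r' ≤ -1 := by omega
      nlinarith
    have hr'r : r' ≤ r := by
      by_contra hc
      have : r + 1 ≤ r' := by omega
      nlinarith
    have hr'q : r' ≤ q' := by
      by_contra hc
      have : q' + 1 ≤ r' := by omega
      nlinarith
    have hrR : (1:ℝ) ≤ r := by exact_mod_cast hrpos
    have hr'R : (0:ℝ) ≤ r' := by exact_mod_cast hr'0
    have hrqR : (r:ℝ) + 1 ≤ q := by exact_mod_cast hrq
    have hr'qR : (r':ℝ) ≤ q' := by exact_mod_cast hr'q
    have hden : 0 < (r:ℝ) * y + r' := by nlinarith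
    have hnum : (r:ℝ) * y + r' < q * y + q' := by nlinarith
    have hnum0 : 0 < (q:ℝ) * y + q' := by linarith
    have hxe : x = ((r:ℝ) * y + r') / (q * y + q') + (a : ℝ) := by
      have h1 : (p:ℝ) = q * a + r := by exact_mod_cast hpa
      have h2 : (r':ℝ) = p' - a * q' := by rw [hr']; push_cast; ring
      field_simp
      linear_combination hx + y * h1 - h2
    have hf : Int.fract x = ((r:ℝ) * y + r') / (q * y + q') := by
      rw [hxe, Int.fract_add_intCast, Int.fract_eq_self]
      refine ⟨by positivity, ?_⟩
      rw [div_lt_one hnum0]; exact hnum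
    obtain ⟨k, hk⟩ := ih r.toNat (by omega) q q' r r' (((q:ℝ) * y + q') / (r * y + r')) y rfl
      (by omega) hr'0 hr'r (by omega) hy (by field_simp)
    refine ⟨k + 1, ?_⟩
    rw [Function.iterate_succ_apply, hf, gaussMap, inv_div, hk]

theorem gaussMap_iterate_near_rational (p q : ℤ) (hq : 0 < q) (hpq : IsCoprime p q) (ε : ℤ)
    (hε : ε = 1 ∨ ε = -1) : ∃ c : ℝ, 0 ≤ c ∧ c ≤ 1 ∧ ∀ x y : ℝ, 2 < y →
      (x - p / q) * (q ^ 2 * (y + c)) = ε →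
      ∃ k : ℕ, gaussMap^[k] (Int.fract x) = Int.fract y := by
  obtain ⟨u, v, huv⟩ := hpq
  set q' := (-ε * u) % q with hq'
  have h0 : 0 ≤ q' := Int.emod_nonneg _ (by omega)
  have h1 : q' < q := Int.emod_lt_of_pos _ hq
  set d := (-ε * u) / q with hd
  have h2 : q * d + q' = -ε * u := Int.mul_ediv_add_emod _ _
  set p' := ε * v - p * d with hp'
  have hdet : p * q' - p' * q = -ε := by
    have : q' = -ε * u - q * d := by linarith
    rw [this, hp']
    linear_combination -ε * huv
  have hqR : (0:ℝ) < q := by exact_mod_cast hq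
  have h0R : (0:ℝ) ≤ q' := by exact_mod_cast h0
  have h1R : (q':ℝ) < q := by exact_mod_cast h1
  refine ⟨q' / q, by positivity, by rw [div_le_one hqR]; exact h1R.le, ?_⟩
  intro x y hy hx
  refine gaussMap_iterate_of_moebius q.toNat p p' q q' x y rfl (by omega) h0 h1.le ?_ hy ?_
  · rcases hε with h | h <;> rw [h] at hdet <;> omega
  · have hdetR : (p:ℝ) * q' - p' * q = -ε := by exact_mod_cast hdet
    have hx' : (x * q - p) * (q * y + q') = ε := by
      rw [← hx]; field_simp
    have : q * (x * (q * y + q')) = q * (p * y + p') := by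
      linear_combination hx' + hdetR
    exact mul_left_cancel₀ hqR.ne' this

/-- The natural numbers with `m` base-`B` digits, all in `D`. -/
def digitWords (B : ℕ) (D : Finset ℕ) : ℕ → Finset ℕ
  | 0 => {0}
  | m + 1 => (digitWords B D m ×ˢ D).image fun p => B * p.1 + p.2

/-- The number whose base-`B` digits are the first `m` terms of `ω`. -/
def digitPrefix (B : ℕ) (ω : ℕ → ℕ) : ℕ → ℕ
  | 0 => 0
  | m + 1 => B * digitPrefix B ω m + ω m

/-- The real number with base-`B` digits `ω`. -/
def digitValue (B : ℕ) (ω : ℕ → ℕ) : ℝ := ∑' i, (ω i : ℝ) / (B : ℝ) ^ (i + 1)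

theorem digitWords_succ (B : ℕ) (D : Finset ℕ) (m : ℕ) : digitWords B D (m + 1) =
    (digitWords B D m ×ˢ D).image fun p => B * p.1 + p.2 := rfl

theorem mem_digitWords_succ {B : ℕ} {D : Finset ℕ} {m w : ℕ} :
    w ∈ digitWords B D (m + 1) ↔ ∃ a ∈ digitWords B D m, ∃ d ∈ D, B * a + d = w := by
  simp [digitWords_succ, and_assoc]

theorem digitWords_lt {B : ℕ} {D : Finset ℕ} (hD : ∀ d ∈ D, d < B) {m w : ℕ}
    (hw : w ∈ digitWords B D m) : w < B ^ m := by
  induction m generalizing w with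
  | zero => simp [digitWords] at hw; simp [hw]
  | succ m ih =>
    obtain ⟨a, ha, d, hd, rfl⟩ := mem_digitWords_succ.1 hw
    have h1 := ih ha
    have h2 := hD d hd
    calc B * a + d < B * (a + 1) := by rw [mul_add]; omega
      _ ≤ B * B ^ m := Nat.mul_le_mul_left _ h1
      _ = B ^ (m + 1) := by ring

theorem digitWords_append {B : ℕ} {D : Finset ℕ} {m k a b : ℕ} (ha : a ∈ digitWords B D m)
    (hb : b ∈ digitWords B D k) : a * B ^ k + b ∈ digitWords B D (m + k) := by
  induction k generalizing b with
  | zero => simp [digitWords] at hb; simpa [hb] using ha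
  | succ k ih =>
    obtain ⟨c, hc, d, hd, rfl⟩ := mem_digitWords_succ.1 hb
    exact mem_digitWords_succ.2 ⟨_, ih hc, d, hd, by ring⟩

theorem digit_injective {B : ℕ} {a d a' d' : ℕ} (hd : d < B) (hd' : d' < B)
    (h : B * a + d = B * a' + d') : a = a' ∧ d = d' := by
  have hB : 0 < B := by omega
  have h1 : (B * a + d) / B = a := by
    rw [Nat.mul_add_div hB, Nat.div_eq_of_lt hd, add_zero]
  have h2 : (B * a' + d') / B = a' := by
    rw [Nat.mul_add_div hB, Nat.div_eq_of_lt hd', add_zero]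
  have h3 : a = a' := by rw [← h1, ← h2, h]
  subst h3
  exact ⟨rfl, by omega⟩

theorem digitWords_injOn {B : ℕ} {D : Finset ℕ} (hD : ∀ d ∈ D, d < B) (W : Finset ℕ) :
    Set.InjOn (fun p : ℕ × ℕ => B * p.1 + p.2) (W ×ˢ D : Finset (ℕ × ℕ)) := by
  rintro ⟨a, d⟩ h ⟨a', d'⟩ h' he
  simp only [Finset.coe_product, Set.mem_prod, Finset.mem_coe] at h h'
  obtain ⟨h1, h2⟩ := digit_injective (hD d h.2) (hD d' h'.2) he
  exact Prod.ext h1 h2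

theorem sum_digitWords_succ {B : ℕ} {D : Finset ℕ} (hD : ∀ d ∈ D, d < B) {M : Type*}
    [AddCommMonoid M] (m : ℕ) (f : ℕ → M) : ∑ w ∈ digitWords B D (m + 1), f w =
      ∑ a ∈ digitWords B D m, ∑ d ∈ D, f (B * a + d) := by
  rw [digitWords_succ, Finset.sum_image (digitWords_injOn hD _), Finset.sum_product]

theorem card_digitWords {B : ℕ} {D : Finset ℕ} (hD : ∀ d ∈ D, d < B) (m : ℕ) :
    (digitWords B D m).card = D.card ^ m := by
  induction m with
  | zero => simp [digitWords]
  | succ m ih =>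
    rw [digitWords_succ, Finset.card_image_of_injOn (digitWords_injOn hD _), Finset.card_product,
      ih, pow_succ]

theorem digitPrefix_mem {B : ℕ} {D : Finset ℕ} {ω : ℕ → ℕ} (hω : ∀ i, ω i ∈ D) (m : ℕ) :
    digitPrefix B ω m ∈ digitWords B D m := by
  induction m with
  | zero => simp [digitPrefix, digitWords]
  | succ m ih => exact mem_digitWords_succ.2 ⟨_, ih, _, hω m, rfl⟩

theorem digitPrefix_eq_iff {B : ℕ} {ω ω' : ℕ → ℕ} (hω : ∀ i, ω i < B) (hω' : ∀ i, ω' i < B)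
    (m : ℕ) : digitPrefix B ω m = digitPrefix B ω' m ↔ ∀ i < m, ω i = ω' i := by
  induction m with
  | zero => simp [digitPrefix]
  | succ m ih =>
    refine ⟨fun h => ?_, fun h => ?_⟩
    · obtain ⟨h1, h2⟩ := digit_injective (hω m) (hω' m) h
      intro i hi
      rcases Nat.lt_succ_iff_lt_or_eq.1 hi with h | rfl
      · exact ih.1 h1 i h
      · exact h2
    · rw [digitPrefix, digitPrefix, ih.2 fun i hi => h i (by omega), h m (by omega)]

theorem exists_digitPrefix_eq {B : ℕ} {D : Finset ℕ} (hne : D.Nonempty) {m w : ℕ}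
    (hw : w ∈ digitWords B D m) : ∃ ω : ℕ → ℕ, (∀ i, ω i ∈ D) ∧ digitPrefix B ω m = w := by
  induction m generalizing w with
  | zero =>
    obtain ⟨d, hd⟩ := hne
    exact ⟨fun _ => d, fun _ => hd, by simpa [digitWords, digitPrefix, eq_comm] using hw⟩
  | succ m ih =>
    obtain ⟨a, ha, d, hd, rfl⟩ := mem_digitWords_succ.1 hw
    obtain ⟨ω, h1, h2⟩ := ih ha
    refine ⟨fun i => if i < m then ω i else d, fun i => by dsimp; split_ifs <;> simp [h1, hd], ?_⟩
    have key : ∀ k ≤ m, digitPrefix B (fun i => if i < m then ω i else d) k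
        = digitPrefix B ω k := by
      intro k hk
      induction k with
      | zero => rfl
      | succ k ihk => rw [digitPrefix, digitPrefix, ihk (by omega), if_pos (by omega)]
    rw [digitPrefix, key m le_rfl, h2, if_neg (lt_irrefl m)]

theorem hasSum_top_digit {B : ℕ} (hB : 2 ≤ B) :
    HasSum (fun i : ℕ => ((B : ℝ) - 1) / (B : ℝ) ^ (i + 1)) 1 := by
  have hB' : (2:ℝ) ≤ B := by exact_mod_cast hB
  have := (hasSum_geometric_of_lt_one (r := (B:ℝ)⁻¹) (by positivity)
    (inv_lt_one_of_one_lt₀ (by linarith))).mul_left (((B:ℝ) - 1) / B)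
  have h1 : (B:ℝ) - 1 ≠ 0 := by linarith
  have h2 : (1 - (B:ℝ)⁻¹) = (B - 1) / B := by field_simp
  have h3 : ((B:ℝ) - 1) / B * (1 - (B:ℝ)⁻¹)⁻¹ = 1 := by rw [h2]; field_simp
  have h4 : (fun i : ℕ => ((B : ℝ) - 1) / (B : ℝ) ^ (i + 1)) =
      fun i => ((B:ℝ) - 1) / B * (B:ℝ)⁻¹ ^ i := by
    funext i; rw [inv_pow, pow_succ]; field_simp
  rw [h4]; rwa [h3] at this

theorem digit_term_le {B : ℕ} {ω : ℕ → ℕ} (hω : ∀ i, ω i < B) (i : ℕ) :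
    (ω i : ℝ) / (B : ℝ) ^ (i + 1) ≤ ((B : ℝ) - 1) / (B : ℝ) ^ (i + 1) := by
  have : (ω i : ℝ) + 1 ≤ B := by exact_mod_cast hω i
  gcongr; linarith

theorem summable_digit {B : ℕ} (hB : 2 ≤ B) {ω : ℕ → ℕ} (hω : ∀ i, ω i < B) :
    Summable fun i => (ω i : ℝ) / (B : ℝ) ^ (i + 1) :=
  Summable.of_nonneg_of_le (fun i => by positivity) (digit_term_le hω)
    (hasSum_top_digit hB).summable

theorem digitValue_nonneg (B : ℕ) (ω : ℕ → ℕ) : 0 ≤ digitValue B ω :=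
  tsum_nonneg fun i => by positivity

theorem digitValue_le_one {B : ℕ} (hB : 2 ≤ B) {ω : ℕ → ℕ} (hω : ∀ i, ω i < B) :
    digitValue B ω ≤ 1 := by
  rw [← (hasSum_top_digit hB).tsum_eq]
  exact Summable.tsum_le_tsum (digit_term_le hω) (summable_digit hB hω)
    (hasSum_top_digit hB).summable

theorem digitValue_eq_prefix_add {B : ℕ} (hB : 2 ≤ B) {ω : ℕ → ℕ} (hω : ∀ i, ω i < B) (m : ℕ) :
    digitValue B ω = (digitPrefix B ω m + digitValue B fun i => ω (i + m)) / (B : ℝ) ^ m := by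
  have hB' : (B:ℝ) ≠ 0 := by positivity
  induction m with
  | zero => simp [digitPrefix]
  | succ m ih =>
    rw [ih]
    have : digitValue B (fun i => ω (i + m)) =
        (ω m + digitValue B fun i => ω (i + (m + 1))) / B := by
      rw [digitValue, (summable_digit hB (ω := fun i => ω (i + m))
        fun i => hω _).tsum_eq_zero_add, digitValue, add_div, ← tsum_div_const]
      simp only [zero_add, pow_one]
      congr 2
      funext i
      rw [show i + 1 + m = i + (m + 1) by ring, pow_succ _ (i + 1)]
      field_simp
    rw [this, digitPrefix]
    push_cast
    field_simp
    ring

theorem digitValue_mem_Icc {B : ℕ} (hB : 2 ≤ B) {ω : ℕ → ℕ} (hω : ∀ i, ω i < B) (m : ℕ) :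
    digitValue B ω ∈ Icc ((digitPrefix B ω m : ℝ) / (B : ℝ) ^ m)
      ((digitPrefix B ω m + 1) / (B : ℝ) ^ m) := by
  rw [digitValue_eq_prefix_add hB hω m]
  have h0 := digitValue_nonneg B fun i => ω (i + m)
  have h1 := digitValue_le_one hB (ω := fun i => ω (i + m)) fun i => hω _
  constructor <;> gcongr
  linarith

/-- Independent uniformly distributed digits in `D`. -/
def digitMeasure (D : Finset ℕ) : Measure (ℕ → ℕ) :=
  Measure.infinitePi fun _ => ProbabilityTheory.uniformOn (D : Set ℕ)

theorem digitMeasure_isProbabilityMeasure {D : Finset ℕ} (hD : D.Nonempty) :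
    IsProbabilityMeasure (digitMeasure D) := by
  have : IsProbabilityMeasure (ProbabilityTheory.uniformOn (D : Set ℕ)) :=
    ProbabilityTheory.isProbabilityMeasure_uniformOn D.finite_toSet (by simpa using hD)
  unfold digitMeasure
  infer_instance

theorem ae_mem_digits {D : Finset ℕ} (hD : D.Nonempty) :
    ∀ᵐ ω ∂digitMeasure D, ∀ i, ω i ∈ D := by
  have : IsProbabilityMeasure (ProbabilityTheory.uniformOn (D : Set ℕ)) :=
    ProbabilityTheory.isProbabilityMeasure_uniformOn D.finite_toSet (by simpa using hD)
  rw [ae_all_iff]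
  intro i
  have h := Measure.infinitePi_pi (μ := fun _ : ℕ => ProbabilityTheory.uniformOn (D : Set ℕ))
    (s := {i}) (t := fun _ => ((D : Set ℕ))ᶜ) (fun _ _ => D.measurableSet.compl)
  rw [Finset.prod_singleton] at h
  have h0 : ProbabilityTheory.uniformOn (D : Set ℕ) ((D : Set ℕ))ᶜ = 0 := by
    rw [ProbabilityTheory.uniformOn, ProbabilityTheory.cond_apply D.measurableSet]; simp
  rw [h0] at h
  rw [ae_iff]
  refine Eq.trans ?_ h
  rw [digitMeasure]
  congr 1
  ext ω; simp

theorem digitMeasure_cylinder {D : Finset ℕ} (hD : D.Nonempty) (m : ℕ) (ω' : ℕ → ℕ)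
    (h' : ∀ i, ω' i ∈ D) :
    digitMeasure D {ω | ∀ i < m, ω i = ω' i} = ((D.card : ℝ≥0∞)⁻¹) ^ m := by
  have : IsProbabilityMeasure (ProbabilityTheory.uniformOn (D : Set ℕ)) :=
    ProbabilityTheory.isProbabilityMeasure_uniformOn D.finite_toSet (by simpa using hD)
  have h := Measure.infinitePi_pi (μ := fun _ : ℕ => ProbabilityTheory.uniformOn (D : Set ℕ))
    (s := Finset.range m) (t := fun i => {ω' i}) (fun _ _ => measurableSet_singleton _)
  have h0 : ∀ i, ProbabilityTheory.uniformOn (D : Set ℕ) {ω' i} = (D.card : ℝ≥0∞)⁻¹ := by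
    intro i
    have := ProbabilityTheory.uniformOn_apply_finset (s := D) (t := {ω' i})
    rw [Finset.inter_singleton_of_mem (h' i)] at this
    simpa using this
  simp only [h0, Finset.prod_const, Finset.card_range] at h
  rw [← h, digitMeasure]
  congr 1
  ext ω; simp

theorem digitMeasure_prefix_le {B : ℕ} {D : Finset ℕ} (hD : D.Nonempty) (hDB : ∀ d ∈ D, d < B)
    (m w : ℕ) : digitMeasure D {ω | digitPrefix B ω m = w} ≤ ((D.card : ℝ≥0∞)⁻¹) ^ m := by
  have hae := ae_mem_digits hD
  by_cases hw : w ∈ digitWords B D m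
  · obtain ⟨ω', h1, h2⟩ := exists_digitPrefix_eq hD hw
    rw [← digitMeasure_cylinder hD m ω' h1]
    apply measure_mono_ae
    filter_upwards [hae] with ω hω h
    have h : digitPrefix B ω m = w := h
    exact (digitPrefix_eq_iff (fun i => hDB _ (hω i)) (fun i => hDB _ (h1 i)) m).1 (h.trans h2.symm)
  · refine le_of_eq_of_le ?_ zero_le
    refine measure_mono_null ?_ (ae_iff.1 hae)
    intro ω h hω
    have h : digitPrefix B ω m = w := h
    exact hw (h ▸ digitPrefix_mem hω m)

theorem digitMeasure_prefix_mem_le {B : ℕ} {D : Finset ℕ} (hD : D.Nonempty)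
    (hDB : ∀ d ∈ D, d < B) (m : ℕ) (W : Finset ℕ) :
    digitMeasure D {ω | digitPrefix B ω m ∈ W} ≤ W.card * ((D.card : ℝ≥0∞)⁻¹) ^ m := by
  have : {ω | digitPrefix B ω m ∈ W} = ⋃ w ∈ W, {ω | digitPrefix B ω m = w} := by
    ext ω; simp
  rw [this]
  refine (measure_biUnion_finset_le _ _).trans ?_
  refine (Finset.sum_le_sum fun w _ => digitMeasure_prefix_le hD hDB m w).trans ?_
  simp

theorem measurable_digitPrefix (B m : ℕ) : Measurable fun ω : ℕ → ℕ => digitPrefix B ω m := by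
  induction m with
  | zero => exact measurable_const
  | succ m ih => exact (ih.const_mul B).add (measurable_pi_apply m)

theorem tendsto_digitPrefix_div_pow {B : ℕ} (hB : 2 ≤ B) {ω : ℕ → ℕ} (hω : ∀ i, ω i < B) :
    Tendsto (fun m => (digitPrefix B ω m : ℝ) / (B:ℝ) ^ m) atTop (nhds (digitValue B ω)) := by
  have hB' : (2:ℝ) ≤ B := by exact_mod_cast hB
  have h0 : Tendsto (fun m : ℕ => ((B:ℝ)⁻¹) ^ m) atTop (nhds 0) :=
    tendsto_pow_atTop_nhds_zero_of_lt_one (by positivity)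
      (inv_lt_one_of_one_lt₀ (by linarith))
  have h1 : Tendsto (fun m : ℕ => digitValue B ω - ((B:ℝ)⁻¹) ^ m) atTop
      (nhds (digitValue B ω)) := by simpa using h0.const_sub (digitValue B ω)
  refine tendsto_of_tendsto_of_tendsto_of_le_of_le h1 tendsto_const_nhds ?_ ?_
  · intro m
    have := (digitValue_mem_Icc hB hω m).2
    rw [add_div, one_div, ← inv_pow] at this
    dsimp; linarith
  · intro m
    exact (digitValue_mem_Icc hB hω m).1

theorem aemeasurable_digitValue {B : ℕ} (hB : 2 ≤ B) {D : Finset ℕ} (hD : D.Nonempty)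
    (hDB : ∀ d ∈ D, d < B) : AEMeasurable (digitValue B) (digitMeasure D) := by
  refine aemeasurable_of_tendsto_metrizable_ae atTop
    (f := fun m ω => (digitPrefix B ω m : ℝ) / (B:ℝ) ^ m) ?_ ?_
  · intro m
    refine Measurable.aemeasurable ?_
    exact (measurable_from_nat.comp (measurable_digitPrefix B m)).div_const _
  · filter_upwards [ae_mem_digits hD] with ω hω
    exact tendsto_digitPrefix_div_pow hB fun i => hDB _ (hω i)

theorem digitMeasure_value_near {B : ℕ} (hB : 2 ≤ B) {D : Finset ℕ} (hD : D.Nonempty)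
    (hDB : ∀ d ∈ D, d < B) (m : ℕ) (x₀ : ℝ) :
    digitMeasure D {ω | |digitValue B ω - x₀| ≤ ((B:ℝ)⁻¹) ^ m} ≤
      5 * ((D.card : ℝ≥0∞)⁻¹) ^ m := by
  set z := ⌊x₀ * (B:ℝ) ^ m⌋₊ with hz
  have hc : ((Finset.Icc (z - 2) (z + 2)).card : ℝ≥0∞) ≤ 5 := by
    rw [Nat.card_Icc]; exact_mod_cast (by omega : z + 2 + 1 - (z - 2) ≤ 5)
  refine le_trans ?_ ((digitMeasure_prefix_mem_le hD hDB m (Finset.Icc (z - 2) (z + 2))).trans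
    (mul_le_mul_left hc _))
  apply measure_mono_ae
  filter_upwards [ae_mem_digits hD] with ω hω h
  have h : |digitValue B ω - x₀| ≤ ((B:ℝ)⁻¹) ^ m := h
  have hBm : (0:ℝ) < (B:ℝ) ^ m := by positivity
  obtain ⟨h1, h2⟩ := digitValue_mem_Icc hB (fun i => hDB _ (hω i)) m
  rw [div_le_iff₀ hBm] at h1
  rw [le_div_iff₀ hBm] at h2
  rw [abs_le, inv_pow] at h
  have h3 : (digitValue B ω - x₀) * (B:ℝ) ^ m ≤ 1 := by
    calc _ ≤ ((B:ℝ) ^ m)⁻¹ * (B:ℝ) ^ m := mul_le_mul_of_nonneg_right h.2 hBm.le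
      _ = 1 := inv_mul_cancel₀ hBm.ne'
  have h4 : -1 ≤ (digitValue B ω - x₀) * (B:ℝ) ^ m := by
    calc (-1:ℝ) = -((B:ℝ) ^ m)⁻¹ * (B:ℝ) ^ m := by field_simp
      _ ≤ _ := mul_le_mul_of_nonneg_right h.1 hBm.le
  change digitPrefix B ω m ∈ Finset.Icc (z - 2) (z + 2)
  rw [Finset.mem_Icc]
  have h5 : x₀ * (B:ℝ) ^ m < z + 1 := Nat.lt_floor_add_one _
  constructor
  · rw [Nat.sub_le_iff_le_add, hz]
    apply Nat.floor_le_of_le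
    push_cast
    nlinarith
  · have : (digitPrefix B ω m : ℝ) < (z + 2 + 1 : ℕ) := by push_cast; nlinarith
    have := Nat.cast_lt.1 this
    omega

/-- Mass distribution principle for independent uniform digits. -/
theorem le_dimH_of_digitMeasure {B : ℕ} (hB : 2 ≤ B) {D : Finset ℕ} (hD : D.Nonempty)
    (hDB : ∀ d ∈ D, d < B) (hD2 : 2 ≤ D.card)
    (r : NNReal) (hr : (B:ℝ) ^ (r:ℝ) ≤ D.card) (T : Set ℝ)
    (hT : ∀ᵐ ω ∂digitMeasure D, digitValue B ω ∈ T) : (r : ℝ≥0∞) ≤ dimH T := by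
  have hprob := digitMeasure_isProbabilityMeasure hD
  have hmeas := aemeasurable_digitValue hB hD hDB
  have hB' : (2:ℝ) ≤ B := by exact_mod_cast hB
  have hcard : (1:ℝ) ≤ D.card := by exact_mod_cast hD.card_pos
  set ν := (digitMeasure D).map (digitValue B) with hν
  have hball : ∀ (m : ℕ) (x₀ : ℝ), ν (Icc (x₀ - ((B:ℝ)⁻¹) ^ m) (x₀ + ((B:ℝ)⁻¹) ^ m)) ≤
      5 * ((D.card : ℝ≥0∞)⁻¹) ^ m := by
    intro m x₀
    rw [hν, Measure.map_apply_of_aemeasurable hmeas measurableSet_Icc]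
    refine le_trans (measure_mono ?_) (digitMeasure_value_near hB hD hDB m x₀)
    intro ω hω
    have hω : digitValue B ω ∈ Icc _ _ := hω
    change |digitValue B ω - x₀| ≤ ((B:ℝ)⁻¹) ^ m
    rw [abs_le]
    constructor <;> linarith [hω.1, hω.2]
  have hsub : ∀ (m : ℕ) (s : Set ℝ), Metric.ediam s ≤ ENNReal.ofReal (((B:ℝ)⁻¹) ^ m) →
      ν s ≤ 5 * ((D.card : ℝ≥0∞)⁻¹) ^ m := by
    intro m s hs
    rcases s.eq_empty_or_nonempty with rfl | ⟨x₀, hx₀⟩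
    · simp
    refine le_trans (measure_mono ?_) (hball m x₀)
    intro x hx
    have := (Metric.edist_le_ediam_of_mem hx hx₀).trans hs
    rw [edist_dist, ENNReal.ofReal_le_ofReal_iff (by positivity), Real.dist_eq, abs_le] at this
    constructor <;> linarith [this.1, this.2]
  have hD0 : (D.card : ℝ≥0∞) ≠ 0 := Nat.cast_ne_zero.2 (by omega)
  have hC0 : (5 * D.card : ℝ≥0∞) ≠ 0 := mul_ne_zero (by norm_num) hD0
  have hCt : (5 * D.card : ℝ≥0∞) ≠ ∞ := ENNReal.mul_ne_top (by norm_num) (ENNReal.natCast_ne_top _)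
  have hle : (5 * D.card : ℝ≥0∞)⁻¹ • ν ≤ μH[r] := by
    refine Measure.le_hausdorffMeasure _ _ 1 one_pos ?_
    intro s hs
    rw [Measure.smul_apply, smul_eq_mul, ENNReal.inv_mul_le_iff hC0 hCt]
    rcases eq_or_ne (Metric.ediam s) 0 with h0 | h0
    · refine le_of_eq_of_le ?_ zero_le
      have hlim : Tendsto (fun m : ℕ => 5 * ((D.card : ℝ≥0∞)⁻¹) ^ m) atTop (nhds (5 * 0)) :=
        ENNReal.Tendsto.const_mul (ENNReal.tendsto_pow_atTop_nhds_zero_of_lt_one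
          (ENNReal.inv_lt_one.2 (by exact_mod_cast hD2))) (Or.inr ENNReal.ofNat_ne_top)
      rw [mul_zero] at hlim
      exact le_antisymm (ge_of_tendsto' hlim fun m => hsub m s (by rw [h0]; exact zero_le))
        zero_le
    have htop : Metric.ediam s ≠ ∞ := ne_top_of_le_ne_top ENNReal.one_ne_top hs
    set δ := (Metric.ediam s).toReal with hδ
    have hδ0 : 0 < δ := ENNReal.toReal_pos h0 htop
    have hδ1 : δ ≤ 1 := ENNReal.toReal_le_of_le_ofReal zero_le_one (by rwa [ENNReal.ofReal_one])
    have hδe : Metric.ediam s = ENNReal.ofReal δ := (ENNReal.ofReal_toReal htop).symm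
    obtain ⟨m, hm1, hm2⟩ := exists_nat_pow_near_of_lt_one hδ0 hδ1
      (y := (B:ℝ)⁻¹) (by positivity) (inv_lt_one_of_one_lt₀ (by linarith))
    refine (hsub m s (by rw [hδe]; exact ENNReal.ofReal_le_ofReal hm2)).trans ?_
    have hreal : ((D.card:ℝ)⁻¹) ^ (m + 1) ≤ δ ^ (r:ℝ) := by
      calc ((D.card:ℝ)⁻¹) ^ (m + 1) ≤ (((B:ℝ)⁻¹) ^ (r:ℝ)) ^ (m + 1) := by
            refine pow_le_pow_left₀ (inv_nonneg.2 (Nat.cast_nonneg _)) ?_ _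
            rw [Real.inv_rpow (by positivity)]
            exact inv_anti₀ (by positivity) hr
        _ = (((B:ℝ)⁻¹) ^ (m + 1)) ^ (r:ℝ) := by
            rw [← Real.rpow_mul_natCast (by positivity), ← Real.rpow_natCast_mul (by positivity),
              mul_comm]
        _ ≤ δ ^ (r:ℝ) := Real.rpow_le_rpow (by positivity) hm1.le (by positivity)
    have henn : ((D.card : ℝ≥0∞)⁻¹) ^ (m + 1) ≤ Metric.ediam s ^ (r:ℝ) := by
      rw [hδe, ENNReal.ofReal_rpow_of_pos hδ0]
      refine le_of_eq_of_le ?_ (ENNReal.ofReal_le_ofReal hreal)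
      rw [ENNReal.ofReal_pow (inv_nonneg.2 (Nat.cast_nonneg _)),
        ENNReal.ofReal_inv_of_pos (by linarith), ENNReal.ofReal_natCast]
    refine le_trans (le_of_eq ?_) (mul_le_mul_right henn _)
    rw [pow_succ']
    rw [mul_assoc, ← mul_assoc (D.card : ℝ≥0∞), ENNReal.mul_inv_cancel hD0
      (ENNReal.natCast_ne_top _), one_mul]
  by_contra hlt
  have hdim : μH[r] T = 0 := hausdorffMeasure_of_dimH_lt (not_le.1 hlt)
  have h1 : ν T = 0 := by
    have := hle T
    rw [hdim, Measure.smul_apply, smul_eq_mul, nonpos_iff_eq_zero, mul_eq_zero] at this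
    exact this.resolve_left (ENNReal.inv_ne_zero.2 hCt)
  have h2 : digitMeasure D (digitValue B ⁻¹' T) = 0 := Measure.preimage_null_of_map_null hmeas h1
  have h3 : ∀ᵐ ω ∂digitMeasure D, False := by
    filter_upwards [hT, measure_eq_zero_iff_ae_notMem.1 h2] with ω h h' using h' h
  simp only [eventually_false_iff_eq_bot, ae_eq_bot] at h3
  exact hprob.ne_zero _ h3

theorem card_digits_meeting_le (B : ℕ) (τ : UnitAddCircle) :
    ∃ E : Finset ℕ, E.card ≤ 3 ∧ ∀ b < B, ∀ x ∈ Icc ((b:ℝ) / B) ((b + 1 : ℝ) / B),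
      (x : UnitAddCircle) = τ → b ∈ E := by
  obtain ⟨y₀, hy₀⟩ := QuotientAddGroup.mk_surjective τ
  set y := Int.fract y₀ with hy
  have hy0 : 0 ≤ y := Int.fract_nonneg _
  have hy1 : y < 1 := Int.fract_lt_one _
  refine ⟨{⌊B * y⌋₊, ⌊B * y⌋₊ - 1, B - 1}, Finset.card_le_three, ?_⟩
  intro b hb x hx hxτ
  have hB : (0:ℝ) < B := by exact_mod_cast (by omega : 0 < B)
  have hbB : (b:ℝ) + 1 ≤ B := by exact_mod_cast hb
  have hx0 : 0 ≤ x := le_trans (by positivity) hx.1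
  have hx1 : x ≤ 1 := hx.2.trans (by rw [div_le_one hB]; exact hbB)
  obtain ⟨h1, h2⟩ := hx
  rw [div_le_iff₀ hB] at h1
  rw [le_div_iff₀ hB] at h2
  have hsub : ((x - y₀ : ℝ) : UnitAddCircle) = 0 := by
    rw [AddCircle.coe_sub, hxτ, ← hy₀]
    exact sub_self _
  obtain ⟨k, hk⟩ := (AddCircle.coe_eq_zero_iff (1:ℝ)).1 hsub
  rw [zsmul_eq_mul, mul_one] at hk
  have hxy : x - y = ((k + ⌊y₀⌋ : ℤ) : ℝ) := by
    rw [hy, Int.fract]; push_cast; linarith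
  have hlow : -1 < k + ⌊y₀⌋ := by
    have : (-1:ℝ) < ((k + ⌊y₀⌋ : ℤ) : ℝ) := by rw [← hxy]; linarith
    exact_mod_cast this
  simp only [Finset.mem_insert, Finset.mem_singleton]
  rcases (by omega : k + ⌊y₀⌋ = 0 ∨ 1 ≤ k + ⌊y₀⌋) with h | h
  · rw [h, Int.cast_zero, sub_eq_zero] at hxy
    rw [hxy] at h1 h2
    rcases h2.lt_or_eq with h3 | h3
    · left
      refine ((Nat.floor_eq_iff (by positivity)).2 ⟨?_, ?_⟩).symm <;> linarith
    · right; left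
      have : ⌊B * y⌋₊ = b + 1 := by
        rw [mul_comm, h3, show (b:ℝ) + 1 = ((b + 1 : ℕ) : ℝ) by push_cast; ring, Nat.floor_natCast]
      omega
  · have h4 : (1:ℝ) ≤ ((k + ⌊y₀⌋ : ℤ) : ℝ) := by exact_mod_cast h
    have hxe : x = 1 := by linarith
    rw [hxe, one_mul] at h2
    have : B ≤ b + 1 := by exact_mod_cast h2
    right; right; omega

theorem exists_digits_avoiding (n : ℕ) (hn : 2 ≤ n) (S : Set UnitAddCircle) (hS : S.Finite)
    (N : ℕ) (hN : 0 < N) : ∃ D : Finset ℕ, (∀ d ∈ D, d < n ^ N) ∧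
      n ^ N ≤ D.card + 3 * S.ncard * N ∧
      ∀ ω : ℕ → ℕ, (∀ i, ω i ∈ D) → closure (Set.range fun k : ℕ =>
        (fun x : UnitAddCircle => n • x)^[k] (digitValue (n ^ N) ω : UnitAddCircle)) ∩ S = ∅ := by
  classical
  set B := n ^ N with hBdef
  have hB : 2 ≤ B := hn.trans (Nat.le_self_pow hN.ne' n)
  choose E hE1 hE2 using card_digits_meeting_le B
  set W := hS.toFinset.biUnion fun s => (Finset.range N).biUnion fun i => E (n ^ i • s) with hW
  have hWcard : W.card ≤ 3 * S.ncard * N := by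
    calc W.card ≤ hS.toFinset.card * (N * 3) := by
          refine Finset.card_biUnion_le_card_mul _ _ _ fun s _ => ?_
          refine (Finset.card_biUnion_le_card_mul _ _ 3 fun i _ => hE1 _).trans ?_
          simp
      _ = 3 * S.ncard * N := by rw [Set.ncard_eq_toFinset_card S hS]; ring
  refine ⟨Finset.range B \ W, fun d hd => ?_, ?_, ?_⟩
  · exact Finset.mem_range.1 (Finset.mem_sdiff.1 hd).1
  · have := Finset.le_card_sdiff W (Finset.range B)
    rw [Finset.card_range] at this
    omega
  intro ω hω
  have hωB : ∀ i, ω i < B := fun i => Finset.mem_range.1 (Finset.mem_sdiff.1 (hω i)).1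
  set K : Set UnitAddCircle := ⋃ b ∈ Finset.range B \ W,
    (fun x : ℝ => (x : UnitAddCircle)) '' Icc ((b:ℝ) / B) ((b + 1 : ℝ) / B) with hK
  have hKc : IsClosed K := by
    refine (Finset.isCompact_biUnion _ fun b _ => ?_).isClosed
    exact isCompact_Icc.image (AddCircle.continuous_mk' 1)
  set C : Set UnitAddCircle := ⋃ i ∈ Finset.range N, (fun y => n ^ i • y) ⁻¹' K with hC
  have hCc : IsClosed C := isClosed_biUnion_finset fun i _ => hKc.preimage (continuous_nsmul _)
  have hsub : (Set.range fun k : ℕ =>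
      (fun x : UnitAddCircle => n • x)^[k] (digitValue B ω : UnitAddCircle)) ⊆ C := by
    rintro _ ⟨k, rfl⟩
    have hiter : ∀ (k : ℕ) (z : UnitAddCircle),
        (fun x : UnitAddCircle => n • x)^[k] z = n ^ k • z := by
      intro k z
      induction k with
      | zero => simp
      | succ k ih => rw [Function.iterate_succ_apply', ih, pow_succ', mul_smul]
    simp only [hiter, hC, Set.mem_iUnion, Set.mem_preimage, Finset.mem_range]
    obtain ⟨i, hi, j, hj⟩ : ∃ i < N, ∃ j, i + k = N * j := by
      rcases Nat.eq_zero_or_pos (k % N) with h | h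
      · exact ⟨0, hN, k / N, by have := Nat.mod_add_div k N; omega⟩
      · have := Nat.mod_add_div k N
        have h2 := Nat.mod_lt k hN
        exact ⟨N - k % N, by omega, k / N + 1, by rw [mul_add]; omega⟩
    refine ⟨i, hi, ?_⟩
    have hval : (n ^ i • n ^ k • (digitValue B ω : UnitAddCircle)) =
        ((digitValue B fun l => ω (l + j) : ℝ) : UnitAddCircle) := by
      rw [← mul_smul, ← pow_add, hj, pow_mul, ← hBdef, ← AddCircle.coe_nsmul, nsmul_eq_mul,
        digitValue_eq_prefix_add hB hωB j]
      have : ((B ^ j : ℕ) : ℝ) *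
          ((digitPrefix B ω j + digitValue B fun i => ω (i + j)) / (B : ℝ) ^ j) = (digitValue B fun i => ω (i + j)) + (digitPrefix B ω j) • (1:ℝ) := by
        push_cast; rw [nsmul_eq_mul]; field_simp; ring
      rw [this, AddCircle.coe_add, AddCircle.coe_nsmul, AddCircle.coe_period, smul_zero, add_zero]
    rw [hval, hK]
    simp only [Set.mem_iUnion]
    refine ⟨ω j, hω j, _, ?_, rfl⟩
    have := digitValue_mem_Icc hB (ω := fun l => ω (l + j)) (fun i => hωB _) 1
    simpa [digitPrefix] using this
  rw [← Set.disjoint_iff_inter_eq_empty]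
  refine Set.disjoint_of_subset_left (closure_minimal hsub hCc) ?_
  rw [Set.disjoint_left]
  intro y hy hyS
  simp only [hC, hK, Set.mem_iUnion, Set.mem_preimage, Finset.mem_range] at hy
  obtain ⟨i, hi, b, hb, x, hx, hxy⟩ := hy
  rw [Finset.mem_sdiff, Finset.mem_range] at hb
  refine hb.2 ?_
  rw [hW, Finset.mem_biUnion]
  refine ⟨y, hS.mem_toFinset.2 hyS, ?_⟩
  rw [Finset.mem_biUnion]
  exact ⟨i, Finset.mem_range.2 hi, hE2 _ b hb.1 x hx hxy⟩

/-- The character `x ↦ exp (2πix)`. -/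
def expChar (x : ℝ) : ℂ := Complex.exp (2 * Real.pi * x * Complex.I)

theorem expChar_add (x y : ℝ) : expChar (x + y) = expChar x * expChar y := by
  rw [expChar, expChar, expChar, ← Complex.exp_add]; push_cast; ring_nf

theorem expChar_intCast (k : ℤ) : expChar k = 1 := by
  rw [expChar, Complex.exp_eq_one_iff]; exact ⟨k, by push_cast; ring⟩

theorem expChar_zero : expChar 0 = 1 := by simp [expChar]

theorem norm_expChar (x : ℝ) : ‖expChar x‖ = 1 := by
  rw [expChar, show (2 * Real.pi * x * Complex.I : ℂ) = ((2 * Real.pi * x : ℝ) : ℂ) * Complex.I by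
    push_cast; ring]
  exact Complex.norm_exp_ofReal_mul_I _

theorem expChar_add_intCast (x : ℝ) (k : ℤ) : expChar (x + k) = expChar x := by
  rw [expChar_add, expChar_intCast, mul_one]

theorem expChar_add_natCast (x : ℝ) (k : ℕ) : expChar (x + k) = expChar x := by
  exact_mod_cast expChar_add_intCast x k

theorem expChar_fract (x : ℝ) : expChar (Int.fract x) = expChar x := by
  rw [← expChar_add_intCast (Int.fract x) ⌊x⌋, Int.fract_add_floor]

theorem conj_expChar (x : ℝ) : (starRingEnd ℂ) (expChar x) = expChar (-x) := by
  rw [expChar, expChar, ← Complex.exp_conj]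
  simp [Complex.conj_ofNat]

theorem expChar_natCast_mul (k : ℕ) (x : ℝ) : expChar (k * x) = expChar x ^ k := by
  rw [expChar, expChar, ← Complex.exp_nat_mul]; push_cast; ring_nf

theorem le_norm_expChar_sub_one {x : ℝ} (h0 : 0 ≤ x) (h1 : x ≤ 1) :
    4 * (x * (1 - x)) ≤ ‖expChar x - 1‖ := by
  have hnorm : ‖expChar x - 1‖ = 2 * Real.sin (Real.pi * x) := by
    rw [expChar, show (2 * Real.pi * x * Complex.I : ℂ) =
      Complex.I * ((2 * Real.pi * x : ℝ) : ℂ) by push_cast; ring,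
      Complex.norm_exp_I_mul_ofReal_sub_one, show 2 * Real.pi * x / 2 = Real.pi * x by ring,
      Real.norm_of_nonneg]
    have := Real.sin_nonneg_of_nonneg_of_le_pi (x := Real.pi * x) (by positivity)
      (by nlinarith [Real.pi_pos])
    positivity
  rw [hnorm]
  have hpi := Real.pi_pos
  rcases le_total x (1 / 2) with h | h
  · have := Real.mul_le_sin (x := Real.pi * x) (by positivity) (by nlinarith)
    rw [show 2 / Real.pi * (Real.pi * x) = 2 * x by field_simp] at this
    nlinarith
  · have := Real.mul_le_sin (x := Real.pi * (1 - x))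
      (mul_nonneg hpi.le (by linarith)) (by nlinarith)
    rw [show 2 / Real.pi * (Real.pi * (1 - x)) = 2 * (1 - x) by field_simp,
      show Real.pi * (1 - x) = Real.pi - Real.pi * x by ring, Real.sin_pi_sub] at this
    nlinarith

theorem norm_sum_expChar_le (s : Finset ℕ) (x : ℝ) :
    ‖∑ k ∈ s, expChar (k * x)‖ ≤ s.card := by
  refine (norm_sum_le _ _).trans ?_
  simp [norm_expChar]

theorem norm_geom_expChar_le (R : ℕ) {x : ℝ} (h0 : 0 < x) (h1 : x < 1) :
    ‖∑ k ∈ Finset.range R, expChar (k * x)‖ ≤ (1 / x + 1 / (1 - x)) / 2 := by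
  have hx : 0 < 4 * (x * (1 - x)) := by have := sub_pos.2 h1; positivity
  have hle := le_norm_expChar_sub_one h0.le h1.le
  have hne : expChar x ≠ 1 := by
    intro h; rw [h, sub_self, norm_zero] at hle; linarith
  simp only [expChar_natCast_mul]
  rw [geom_sum_eq hne, norm_div]
  have hnum : ‖expChar x ^ R - 1‖ ≤ 2 := by
    refine (norm_sub_le _ _).trans ?_
    rw [norm_pow, norm_expChar]; norm_num
  calc ‖expChar x ^ R - 1‖ / ‖expChar x - 1‖ ≤ 2 / (4 * (x * (1 - x))) := by gcongr
    _ = (1 / x + 1 / (1 - x)) / 2 := by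
      have := (sub_pos.2 h1).ne'
      field_simp; ring

/-- The absolute value of the exponential sum over the words of length `k`. -/
def wordSum (B : ℕ) (D : Finset ℕ) (k : ℕ) (x : ℝ) : ℝ :=
  ‖∑ b ∈ digitWords B D k, expChar (b * x)‖

theorem wordSum_add_natCast (B : ℕ) (D : Finset ℕ) (k : ℕ) (x : ℝ) (j : ℕ) :
    wordSum B D k (x + j) = wordSum B D k x := by
  rw [wordSum, wordSum]
  congr 1
  refine Finset.sum_congr rfl fun b _ => ?_
  rw [mul_add, show (b:ℝ) * j = ((b * j : ℕ) : ℝ) by push_cast; ring, expChar_add_natCast]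

theorem wordSum_succ {B : ℕ} {D : Finset ℕ} (hD : ∀ d ∈ D, d < B) (k : ℕ) (x : ℝ) :
    wordSum B D (k + 1) x = wordSum B D k (B * x) * ‖∑ d ∈ D, expChar (d * x)‖ := by
  rw [wordSum, wordSum, sum_digitWords_succ hD, ← norm_mul, Finset.sum_mul_sum]
  congr 1
  refine Finset.sum_congr rfl fun a _ => Finset.sum_congr rfl fun d _ => ?_
  rw [← expChar_add]; congr 1; push_cast; ring

theorem sum_range_mul_eq {M : Type*} [AddCommMonoid M] (a b : ℕ) (f : ℕ → M) :
    ∑ i ∈ Finset.range (a * b), f i =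
      ∑ i ∈ Finset.range a, ∑ j ∈ Finset.range b, f (i * b + j) := by
  induction a with
  | zero => simp
  | succ a ih => rw [Finset.sum_range_succ, ← ih, add_mul, one_mul, Finset.sum_range_add]

theorem sum_wordSum_le {B : ℕ} (hB : 0 < B) {D : Finset ℕ} (hD : ∀ d ∈ D, d < B) {C : ℝ}
    (hC : ∀ θ : ℝ, ∑ r ∈ Finset.range B, ‖∑ d ∈ D, expChar (d * (θ + r / B))‖ ≤ C)
    (k : ℕ) (y : ℝ) :
    ∑ ξ ∈ Finset.range (B ^ k), wordSum B D k ((y + ξ) / (B:ℝ) ^ k) ≤ C ^ k := by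
  have hB' : (B:ℝ) ≠ 0 := by positivity
  have hC0 : 0 ≤ C := (Finset.sum_nonneg fun _ _ => norm_nonneg _).trans (hC 0)
  induction k with
  | zero => simp [wordSum, digitWords, expChar_zero]
  | succ k ih =>
    rw [pow_succ' B k, sum_range_mul_eq, Finset.sum_comm]
    calc ∑ ξ ∈ Finset.range (B ^ k), ∑ r ∈ Finset.range B,
          wordSum B D (k + 1) ((y + (r * B ^ k + ξ : ℕ)) / (B:ℝ) ^ (k + 1))
        = ∑ ξ ∈ Finset.range (B ^ k), wordSum B D k ((y + ξ) / (B:ℝ) ^ k) *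
          ∑ r ∈ Finset.range B,
            ‖∑ d ∈ D, expChar (d * ((y + ξ) / (B:ℝ) ^ (k + 1) + r / B))‖ := by
          refine Finset.sum_congr rfl fun ξ _ => ?_
          rw [Finset.mul_sum]
          refine Finset.sum_congr rfl fun r _ => ?_
          have h1 : (y + (r * B ^ k + ξ : ℕ)) / (B:ℝ) ^ (k + 1) =
              (y + ξ) / (B:ℝ) ^ (k + 1) + r / B := by
            push_cast; field_simp; ring
          have h2 : B * ((y + ξ) / (B:ℝ) ^ (k + 1) + r / B) = (y + ξ) / (B:ℝ) ^ k + r := by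
            field_simp
            ring
          rw [h1, wordSum_succ hD, h2, wordSum_add_natCast]
      _ ≤ ∑ ξ ∈ Finset.range (B ^ k), wordSum B D k ((y + ξ) / (B:ℝ) ^ k) * C :=
          Finset.sum_le_sum fun ξ _ => mul_le_mul_of_nonneg_left (hC _) (norm_nonneg _)
      _ ≤ C ^ k * C := by
          rw [← Finset.sum_mul]; exact mul_le_mul_of_nonneg_right ih hC0
      _ = C ^ (k + 1) := (pow_succ _ _).symm

theorem sum_wordSum_range_le {B : ℕ} (hB : 0 < B) {D : Finset ℕ} (hD : ∀ d ∈ D, d < B) {C : ℝ}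
    (hC : ∀ θ : ℝ, ∑ r ∈ Finset.range B, ‖∑ d ∈ D, expChar (d * (θ + r / B))‖ ≤ C)
    (k τ M : ℕ) :
    ∑ ξ ∈ Finset.range (M * (B ^ k * B ^ τ)), wordSum B D k (ξ / (B:ℝ) ^ (k + τ)) ≤
      M * (B ^ τ * C ^ k) := by
  have hB' : (B:ℝ) ≠ 0 := by positivity
  have hper : ∀ i ξ : ℕ, wordSum B D k ((i * (B ^ k * B ^ τ) + ξ : ℕ) / (B:ℝ) ^ (k + τ)) =
      wordSum B D k (ξ / (B:ℝ) ^ (k + τ)) := by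
    intro i ξ
    rw [← wordSum_add_natCast B D k (ξ / (B:ℝ) ^ (k + τ)) i]
    congr 1
    push_cast; rw [pow_add]; field_simp; ring
  have hone : ∑ ξ ∈ Finset.range (B ^ k * B ^ τ), wordSum B D k (ξ / (B:ℝ) ^ (k + τ)) ≤
      B ^ τ * C ^ k := by
    rw [sum_range_mul_eq, Finset.sum_comm]
    refine (Finset.sum_le_sum (g := fun _ => C ^ k) fun η _ => ?_).trans_eq (by simp)
    refine le_of_eq_of_le (Finset.sum_congr rfl fun ξ _ => ?_)
      (sum_wordSum_le hB hD hC k (η / (B:ℝ) ^ τ))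
    congr 1
    push_cast; rw [pow_add]; field_simp; ring
  rw [sum_range_mul_eq]
  simp only [hper]
  rw [Finset.sum_const, Finset.card_range, nsmul_eq_mul]
  exact mul_le_mul_of_nonneg_left hone (Nat.cast_nonneg _)

theorem sum_norm_geom_expChar_le {B : ℕ} (hB : 2 ≤ B) (θ : ℝ) :
    ∑ r ∈ Finset.range B, ‖∑ d ∈ Finset.range B, expChar (d * (θ + r / B))‖ ≤
      B * (3 + Real.log B) := by
  have hB' : (0:ℝ) < B := by positivity
  set f : ℝ → ℝ := fun φ => ‖∑ d ∈ Finset.range B, expChar (d * φ)‖ with hf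
  have hf1 : ∀ φ, f (φ + 1) = f φ := by
    intro φ
    simp only [hf]
    congr 1
    refine Finset.sum_congr rfl fun d _ => ?_
    rw [mul_add, mul_one, expChar_add_natCast]
  set F : ℝ → ℝ := fun θ => ∑ r ∈ Finset.range B, f (θ + r / B) with hF
  have hper : Function.Periodic F (1 / B) := by
    intro θ
    have h1 := Finset.sum_range_succ (fun r : ℕ => f (θ + r / B)) B
    have h2 := Finset.sum_range_succ' (fun r : ℕ => f (θ + r / B)) B
    rw [div_self hB'.ne', hf1] at h1
    rw [Nat.cast_zero, zero_div, add_zero, h1] at h2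
    have h3 := add_right_cancel h2
    simp only [hF]
    rw [h3]
    refine Finset.sum_congr rfl fun r _ => ?_
    congr 1; push_cast; ring
  set h : ℕ → ℝ := fun j => if j = 0 then 1 else 1 / j / 2 with hh
  have hh0 : ∀ j, 0 ≤ h j := by intro j; simp only [hh]; split_ifs <;> positivity
  have hFh : ∀ θ₀ : ℝ, 0 ≤ θ₀ → θ₀ < 1 / B → F θ₀ ≤ B * (3 + Real.log B) := by
    intro θ₀ h0 h1
    have hterm : ∀ r ∈ Finset.range B, f (θ₀ + r / B) ≤ B * (h r + h (B - 1 - r)) := by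
      intro r hr
      rw [Finset.mem_range] at hr
      have htriv : f (θ₀ + r / B) ≤ B := by
        simpa using norm_sum_expChar_le (Finset.range B) (θ₀ + r / B)
      by_cases hr0 : r = 0
      · refine htriv.trans (le_mul_of_one_le_right hB'.le ?_)
        have : h r = 1 := by simp [hh, hr0]
        linarith [hh0 (B - 1 - r)]
      by_cases hr1 : B - 1 - r = 0
      · refine htriv.trans (le_mul_of_one_le_right hB'.le ?_)
        have : h (B - 1 - r) = 1 := by simp [hh, hr1]
        linarith [hh0 r]
      have hrR : (0:ℝ) < r := by exact_mod_cast Nat.pos_of_ne_zero hr0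
      have hr1R : (0:ℝ) < (B - 1 - r : ℕ) := by exact_mod_cast Nat.pos_of_ne_zero hr1
      have hcast : ((B - 1 - r : ℕ) : ℝ) = B - 1 - r := by
        rw [Nat.cast_sub (by omega), Nat.cast_sub (by omega), Nat.cast_one]
      set φ := θ₀ + r / B with hφ
      have hφ0 : r / B ≤ φ := by linarith
      have hφ1 : ((B - 1 - r : ℕ) : ℝ) / B ≤ 1 - φ := by
        rw [hcast, hφ, sub_div, sub_div, div_self hB'.ne']; linarith
      have hp0 : (0:ℝ) < r / B := by positivity
      have hp1 : (0:ℝ) < ((B - 1 - r : ℕ) : ℝ) / B := by positivity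
      refine (norm_geom_expChar_le B (x := φ) (by linarith) (by linarith)).trans ?_
      simp only [hh, if_neg hr0, if_neg hr1]
      calc (1 / φ + 1 / (1 - φ)) / 2 ≤ (1 / (r / B) + 1 / (((B - 1 - r : ℕ) : ℝ) / B)) / 2 := by
            gcongr
        _ = _ := by field_simp
    have hsum : ∑ r ∈ Finset.range B, h r ≤ (3 + Real.log B) / 2 := by
      obtain ⟨n, rfl⟩ : ∃ n, B = n + 1 := ⟨B - 1, by omega⟩
      rw [Finset.sum_range_succ']
      have h2 : ∑ k ∈ Finset.range n, h (k + 1) = (harmonic n : ℝ) / 2 := by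
        rw [harmonic, Rat.cast_sum, Finset.sum_div]
        refine Finset.sum_congr rfl fun k _ => ?_
        simp [hh]
      have h3 := harmonic_le_one_add_log n
      have h4 : Real.log n ≤ Real.log (n + 1 : ℕ) := by
        rcases Nat.eq_zero_or_pos n with rfl | hn
        · simp
        · exact Real.log_le_log (by exact_mod_cast hn) (by push_cast; linarith)
      have h5 : h 0 = 1 := by simp [hh]
      rw [h2, h5]
      linarith
    calc F θ₀ ≤ ∑ r ∈ Finset.range B, B * (h r + h (B - 1 - r)) := Finset.sum_le_sum hterm
      _ = B * (∑ r ∈ Finset.range B, h r + ∑ r ∈ Finset.range B, h r) := by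
          rw [← Finset.mul_sum, Finset.sum_add_distrib, Finset.sum_range_reflect]
      _ ≤ B * (3 + Real.log B) := by
          refine mul_le_mul_of_nonneg_left ?_ hB'.le
          linarith
  have hred : F θ = F (θ - ⌊θ * B⌋ • (1 / B : ℝ)) := (hper.sub_zsmul_eq _).symm
  change F θ ≤ _
  rw [hred]
  have h1 := Int.floor_le (θ * B)
  have h2 := Int.lt_floor_add_one (θ * B)
  refine hFh _ ?_ ?_
  · rw [zsmul_eq_mul, mul_one_div, sub_nonneg, div_le_iff₀ hB']; exact h1
  · rw [zsmul_eq_mul, mul_one_div, sub_lt_iff_lt_add, ← add_div, lt_div_iff₀ hB']; linarith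

theorem sum_norm_digit_expChar_le {B : ℕ} (hB : 2 ≤ B) {D : Finset ℕ} (hD : ∀ d ∈ D, d < B)
    {b : ℕ} (hb : B ≤ D.card + b) (θ : ℝ) :
    ∑ r ∈ Finset.range B, ‖∑ d ∈ D, expChar (d * (θ + r / B))‖ ≤ B * (3 + Real.log B + b) := by
  have hsub : D ⊆ Finset.range B := fun d hd => Finset.mem_range.2 (hD d hd)
  have hterm : ∀ x : ℝ, ‖∑ d ∈ D, expChar (d * x)‖ ≤
      ‖∑ d ∈ Finset.range B, expChar (d * x)‖ + b := by
    intro x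
    have h1 := Finset.sum_sdiff (f := fun d : ℕ => expChar (d * x)) hsub
    have h2 := norm_sum_expChar_le (Finset.range B \ D) x
    have h3 : ((Finset.range B \ D).card : ℝ) ≤ b := by
      rw [Finset.card_sdiff_of_subset hsub, Finset.card_range]
      exact_mod_cast (by omega : B - D.card ≤ b)
    rw [← sub_eq_iff_eq_add'.2 h1.symm]
    exact (norm_sub_le _ _).trans (by linarith)
  refine (Finset.sum_le_sum fun (r : ℕ) _ => hterm (θ + (r:ℝ) / B)).trans ?_
  rw [Finset.sum_add_distrib, Finset.sum_const, Finset.card_range, nsmul_eq_mul]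
  linarith [sum_norm_geom_expChar_le hB θ]

theorem succ_pow_three_le_two_pow (a : ℕ) : (a + 1) ^ 3 ≤ 8 * 2 ^ a := by
  rcases lt_or_ge a 4 with h | h
  · interval_cases a <;> norm_num
  · induction a, h using Nat.le_induction with
    | base => norm_num
    | succ a ha ih =>
      calc (a + 1 + 1) ^ 3 ≤ 2 * (a + 1) ^ 3 := by
            obtain ⟨b, rfl⟩ := Nat.exists_eq_add_of_le ha
            nlinarith [Nat.zero_le (b ^ 3), Nat.zero_le (b ^ 2)]
        _ ≤ 2 * (8 * 2 ^ a) := by omega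
        _ = 8 * 2 ^ (a + 1) := by ring

theorem card_divisors_pow_three_le {n : ℕ} (hn : n ≠ 0) : n.divisors.card ^ 3 ≤ 8 ^ 8 * n := by
  have hn' : ∏ p ∈ n.primeFactors, p ^ n.factorization p = n :=
    Nat.prod_factorization_pow_eq_self hn
  rw [Nat.card_divisors hn, ← Finset.prod_pow]
  calc ∏ p ∈ n.primeFactors, (n.factorization p + 1) ^ 3
      ≤ ∏ p ∈ n.primeFactors, (if p < 8 then 8 else 1) * p ^ n.factorization p := by
        refine Finset.prod_le_prod' fun p hp => ?_
        split_ifs with h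
        · exact (succ_pow_three_le_two_pow _).trans (Nat.mul_le_mul_left _
            (Nat.pow_le_pow_left (Nat.prime_of_mem_primeFactors hp).two_le _))
        · rw [one_mul]
          calc (n.factorization p + 1) ^ 3 ≤ (2 ^ n.factorization p) ^ 3 :=
                Nat.pow_le_pow_left Nat.lt_two_pow_self _
            _ = 8 ^ n.factorization p := by rw [← pow_mul, mul_comm, pow_mul]; norm_num
            _ ≤ p ^ n.factorization p := Nat.pow_le_pow_left (by omega) _
    _ = (∏ p ∈ n.primeFactors, if p < 8 then 8 else 1) * n := by
        rw [Finset.prod_mul_distrib, hn']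
    _ ≤ 8 ^ 8 * n := by
        refine Nat.mul_le_mul_right _ ?_
        rw [← Finset.prod_filter, Finset.prod_const]
        refine Nat.pow_le_pow_right (by norm_num) ?_
        calc _ ≤ (Finset.range 8).card := Finset.card_le_card fun p hp =>
              Finset.mem_range.2 (Finset.mem_filter.1 hp).2
          _ = 8 := Finset.card_range 8

theorem sum_Ioc_sum_divisors (f : ℕ → ℕ) (hf : f 0 = 0) (X : ℕ) :
    ∑ q ∈ Finset.Ioc 0 X, ∑ d ∈ q.divisors, f d = ∑ d ∈ Finset.Ioc 0 X, f d * (X / d) := by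
  have h := ArithmeticFunction.sum_Ioc_mul_zeta_eq_sum (⟨f, hf⟩ : ArithmeticFunction ℕ) X
  refine (Finset.sum_congr rfl fun q _ => ?_).trans h
  exact (ArithmeticFunction.coe_mul_zeta_apply (f := ⟨f, hf⟩)).symm

/-- Denominators between `X / 4` and `X`. -/
def fareyDenominators (X : ℕ) : Finset ℕ := (Finset.Ioc 0 X).filter fun q => X < 4 * q

theorem le_sum_totient (X : ℕ) :
    (X:ℝ) ^ 2 / 16 ≤ ∑ q ∈ fareyDenominators X, (q.totient : ℝ) := by
  rcases Nat.eq_zero_or_pos X with rfl | hX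
  · simp [fareyDenominators]
  have hXR : (0:ℝ) < X := by exact_mod_cast hX
  have h1 := sum_Ioc_sum_divisors Nat.totient Nat.totient_zero X
  simp only [Nat.sum_totient] at h1
  have h2 : (X:ℝ) * (X + 1) / 2 ≤ ∑ d ∈ Finset.Ioc 0 X, (d.totient : ℝ) * (X / d) := by
    have h3 : (∑ q ∈ Finset.Ioc 0 X, (q:ℝ)) = X * (X + 1) / 2 := by
      clear h1 hX hXR
      induction X with
      | zero => simp
      | succ X ih =>
        rw [← Finset.insert_Ioc_right_eq_Ioc_add_one (by omega), Finset.sum_insert (by simp), ih]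
        push_cast; ring
    rw [← h3, ← Nat.cast_sum, h1, Nat.cast_sum]
    refine Finset.sum_le_sum fun d _ => ?_
    rw [Nat.cast_mul]
    exact mul_le_mul_of_nonneg_left Nat.cast_div_le (Nat.cast_nonneg _)
  rw [← Finset.sum_filter_add_sum_filter_not _ (fun q => X < 4 * q)] at h2
  have h4 : ∑ d ∈ (Finset.Ioc 0 X).filter (fun q => ¬ X < 4 * q), (d.totient : ℝ) * (X / d) ≤
      X / 4 * X := by
    calc _ ≤ ∑ d ∈ (Finset.Ioc 0 X).filter (fun q => ¬ X < 4 * q), (X:ℝ) := by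
          refine Finset.sum_le_sum fun d hd => ?_
          have hd0 : (0:ℝ) < d := by exact_mod_cast (Finset.mem_Ioc.1 (Finset.mem_filter.1 hd).1).1
          have : (d.totient : ℝ) ≤ d := by exact_mod_cast Nat.totient_le d
          rw [← mul_div_assoc, div_le_iff₀ hd0]; nlinarith
      _ ≤ X / 4 * X := by
          rw [Finset.sum_const, nsmul_eq_mul]
          refine mul_le_mul_of_nonneg_right ?_ hXR.le
          have : ((Finset.Ioc 0 X).filter (fun q => ¬ X < 4 * q)).card ≤ X / 4 := by
            calc _ ≤ (Finset.Ioc 0 (X / 4)).card := by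
                  refine Finset.card_le_card fun q hq => ?_
                  rw [Finset.mem_filter, Finset.mem_Ioc] at hq
                  rw [Finset.mem_Ioc]; omega
              _ = X / 4 := by simp
          calc _ ≤ ((X / 4 : ℕ) : ℝ) := by exact_mod_cast this
            _ ≤ X / 4 := by simpa using Nat.cast_div_le (α := ℝ) (m := X) (n := 4)
  have h5 : ∑ d ∈ (Finset.Ioc 0 X).filter (fun q => X < 4 * q), (d.totient : ℝ) * (X / d) ≤
      4 * ∑ q ∈ fareyDenominators X, (q.totient : ℝ) := by
    rw [Finset.mul_sum]
    refine Finset.sum_le_sum fun d hd => ?_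
    rw [Finset.mem_filter, Finset.mem_Ioc] at hd
    have hd0 : (0:ℝ) < d := by exact_mod_cast hd.1.1
    have : (X:ℝ) ≤ 4 * d := by exact_mod_cast hd.2.le
    rw [← mul_div_assoc, div_le_iff₀ hd0]
    nlinarith [(Nat.cast_nonneg d.totient : (0:ℝ) ≤ d.totient)]
  nlinarith

/-- Ramanujan's sum. -/
def ramanujanSum (ξ q : ℕ) : ℂ :=
  ∑ p ∈ (Finset.range q).filter q.Coprime, expChar (ξ * (p / q))

theorem sum_range_expChar_div (ξ n : ℕ) (hn : 0 < n) :
    ∑ p ∈ Finset.range n, expChar (ξ * (p / n)) = if n ∣ ξ then (n:ℂ) else 0 := by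
  have hnR : (n:ℝ) ≠ 0 := by positivity
  have h1 : ∀ p : ℕ, expChar (ξ * (p / n)) = expChar (ξ / n) ^ p := by
    intro p; rw [← expChar_natCast_mul]; congr 1; ring
  simp only [h1]
  split_ifs with h
  · obtain ⟨m, rfl⟩ := h
    have : ((n * m : ℕ) : ℝ) / n = (m : ℤ) := by push_cast; field_simp
    rw [this, expChar_intCast]; simp
  · have hne : expChar (ξ / n) ≠ 1 := by
      intro he
      rw [expChar, Complex.exp_eq_one_iff] at he
      obtain ⟨k, hk⟩ := he
      have hpi : (2 * Real.pi * Complex.I : ℂ) ≠ 0 := by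
        simp [Real.pi_ne_zero]
      have h2 : (((ξ:ℝ) / n : ℝ) : ℂ) = ((k:ℝ) : ℂ) := by
        apply mul_right_cancel₀ hpi
        push_cast at hk ⊢
        linear_combination hk
      have h3 : (ξ:ℝ) = k * n := by rw [← div_eq_iff hnR]; exact_mod_cast h2
      have h4 : (ξ:ℤ) = k * n := by exact_mod_cast h3
      exact h (Int.natCast_dvd_natCast.1 ⟨k, by rw [h4]; ring⟩)
    rw [geom_sum_eq hne, ← expChar_natCast_mul, mul_div_cancel₀ _ hnR,
      show ((ξ:ℝ)) = ((ξ:ℤ):ℝ) by simp, expChar_intCast, sub_self, zero_div]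

theorem sum_divisors_ramanujanSum (ξ n : ℕ) (hn : 0 < n) :
    ∑ i ∈ n.divisors, ramanujanSum ξ i = ∑ p ∈ Finset.range n, expChar (ξ * (p / n)) := by
  have hfib := Finset.sum_fiberwise_of_maps_to (s := Finset.range n) (t := n.divisors)
    (g := fun p => n.gcd p) (fun p _ => Nat.mem_divisors.2 ⟨Nat.gcd_dvd_left _ _, hn.ne'⟩)
    fun p => expChar (ξ * (p / n))
  rw [← hfib, ← Nat.sum_div_divisors n (ramanujanSum ξ)]
  refine Finset.sum_congr rfl fun g hg => ?_
  obtain ⟨m, rfl⟩ := Nat.dvd_of_mem_divisors hg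
  have hg0 : 0 < g := Nat.pos_of_mul_pos_right hn
  have hm0 : 0 < m := Nat.pos_of_mul_pos_left hn
  rw [Nat.mul_div_cancel_left _ hg0, ramanujanSum]
  refine Finset.sum_bij' (fun p _ => g * p) (fun p _ => p / g) ?_ ?_ ?_ ?_ ?_
  · intro p hp
    rw [Finset.mem_filter, Finset.mem_range] at hp ⊢
    refine ⟨Nat.mul_lt_mul_of_pos_left hp.1 hg0, ?_⟩
    rw [Nat.gcd_mul_left, hp.2, mul_one]
  · intro p hp
    rw [Finset.mem_filter, Finset.mem_range] at hp ⊢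
    obtain ⟨k, rfl⟩ : g ∣ p := hp.2 ▸ Nat.gcd_dvd_right _ _
    rw [Nat.gcd_mul_left] at hp
    rw [Nat.mul_div_cancel_left _ hg0]
    exact ⟨Nat.lt_of_mul_lt_mul_left hp.1, Nat.eq_of_mul_eq_mul_left hg0 (by rw [hp.2, mul_one])⟩
  · intro p _; exact Nat.mul_div_cancel_left _ hg0
  · intro p hp
    rw [Finset.mem_filter] at hp
    exact Nat.mul_div_cancel' (hp.2 ▸ Nat.gcd_dvd_right _ _)
  · intro p _
    congr 2
    have : (g:ℝ) ≠ 0 := by positivity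
    push_cast; field_simp

theorem norm_ramanujanSum_le (ξ q : ℕ) (hq : 0 < q) :
    ‖ramanujanSum ξ q‖ ≤ ((∑ d ∈ q.divisors, if d ∣ ξ then d else 0 : ℕ) : ℝ) := by
  have h := (ArithmeticFunction.sum_eq_iff_sum_mul_moebius_eq
    (f := ramanujanSum ξ) (g := fun n => if n ∣ ξ then (n:ℂ) else 0)).1
    (fun n hn => by rw [sum_divisors_ramanujanSum ξ n hn, sum_range_expChar_div ξ n hn]) q hq
  rw [← h]
  refine (norm_sum_le _ _).trans ?_
  rw [Nat.cast_sum, ← Nat.sum_divisorsAntidiagonal' (fun _ d => ((if d ∣ ξ then d else 0 : ℕ) : ℝ))]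
  refine Finset.sum_le_sum fun x _ => ?_
  rw [norm_mul]
  have h1 : ‖((ArithmeticFunction.moebius x.1 : ℤ) : ℂ)‖ ≤ 1 := by
    rw [Complex.norm_intCast]
    exact_mod_cast ArithmeticFunction.abs_moebius_le_one
  have h2 : ‖(if x.2 ∣ ξ then (x.2:ℂ) else 0)‖ = ((if x.2 ∣ ξ then x.2 else 0 : ℕ) : ℝ) := by
    split_ifs <;> simp
  rw [h2]
  exact mul_le_of_le_one_left (Nat.cast_nonneg _) h1

theorem sum_norm_ramanujanSum_le (ξ X : ℕ) (hξ : ξ ≠ 0) :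
    ∑ q ∈ fareyDenominators X, ‖ramanujanSum ξ q‖ ≤ X * ξ.divisors.card := by
  have h1 := sum_Ioc_sum_divisors (fun d => if d ∣ ξ then d else 0) (by simp) X
  calc _ ≤ ∑ q ∈ Finset.Ioc 0 X, ((∑ d ∈ q.divisors, if d ∣ ξ then d else 0 : ℕ) : ℝ) := by
        refine (Finset.sum_le_sum fun q hq => norm_ramanujanSum_le ξ q ?_).trans
          (Finset.sum_le_sum_of_subset_of_nonneg (Finset.filter_subset _ _)
            fun _ _ _ => Nat.cast_nonneg _)
        exact (Finset.mem_Ioc.1 (Finset.mem_filter.1 hq).1).1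
    _ = ((∑ d ∈ Finset.Ioc 0 X, (if d ∣ ξ then d else 0) * (X / d) : ℕ) : ℝ) := by
        rw [← Nat.cast_sum, h1]
    _ ≤ ((X * ξ.divisors.card : ℕ) : ℝ) := by
        refine Nat.cast_le.2 ?_
        calc ∑ d ∈ Finset.Ioc 0 X, (if d ∣ ξ then d else 0) * (X / d)
            ≤ ∑ d ∈ Finset.Ioc 0 X, if d ∣ ξ then X else 0 := by
              refine Finset.sum_le_sum fun d _ => ?_
              split_ifs
              · exact Nat.mul_div_le X d
              · simp
          _ = ((Finset.Ioc 0 X).filter (· ∣ ξ)).card * X := by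
              rw [← Finset.sum_filter, Finset.sum_const, smul_eq_mul]
          _ ≤ X * ξ.divisors.card := by
              rw [mul_comm]
              refine Nat.mul_le_mul_left _ (Finset.card_le_card fun d hd => ?_)
              exact Nat.mem_divisors.2 ⟨(Finset.mem_filter.1 hd).2, hξ⟩
    _ = _ := by push_cast; ring

theorem norm_sum_expChar_neg {ι : Type*} (s : Finset ι) (x : ι → ℝ) :
    ‖∑ i ∈ s, expChar (-x i)‖ = ‖∑ i ∈ s, expChar (x i)‖ := by
  rw [← RCLike.norm_conj (∑ i ∈ s, expChar (x i)), map_sum]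
  simp only [conj_expChar]

theorem ofReal_norm_geom_expChar_sq (R : ℕ) (x : ℝ) :
    ((‖∑ k ∈ Finset.range R, expChar (k * x)‖ ^ 2 : ℝ) : ℂ) =
      ∑ i ∈ Finset.range R, ∑ j ∈ Finset.range R, expChar (((i:ℝ) - j) * x) := by
  have h := Complex.mul_conj' (∑ k ∈ Finset.range R, expChar (k * x))
  push_cast
  rw [← h, map_sum, Finset.sum_mul_sum]
  refine Finset.sum_congr rfl fun i _ => Finset.sum_congr rfl fun j _ => ?_
  rw [conj_expChar, ← expChar_add]; congr 1; ring

theorem sum_fejer_ge {ι κ : Type*} (R : ℕ) (W : Finset κ) (x : κ → ℝ) (F : Finset ι) (f : ι → ℝ)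
    (G : ℕ → ℝ) (hG : ∀ ξ, 0 < ξ → ξ < R →
      ‖∑ b ∈ W, expChar (ξ * x b)‖ * ‖∑ i ∈ F, expChar (ξ * f i)‖ ≤ G ξ) :
    (R:ℝ) * (W.card * F.card) - 2 * R * ∑ ξ ∈ Finset.Ioo 0 R, G ξ ≤
      ∑ b ∈ W, ∑ i ∈ F, ‖∑ k ∈ Finset.range R, expChar (k * (x b - f i))‖ ^ 2 := by
  set g : ℝ → ℂ := fun ξ => (∑ b ∈ W, expChar (ξ * x b)) * ∑ i ∈ F, expChar (-(ξ * f i)) with hg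
  have hg0 : g 0 = W.card * F.card := by simp [hg, expChar_zero]
  have hgn : ∀ ξ : ℕ, 0 < ξ → ξ < R → ‖g ξ‖ ≤ G ξ := by
    intro ξ h0 h1
    rw [hg]; simp only [norm_mul]
    rw [norm_sum_expChar_neg]; exact hG ξ h0 h1
  have hgn' : ∀ ξ : ℕ, 0 < ξ → ξ < R → ‖g (-ξ)‖ ≤ G ξ := by
    intro ξ h0 h1
    rw [hg]; simp only [norm_mul, neg_mul, neg_neg]
    rw [norm_sum_expChar_neg]; exact hG ξ h0 h1
  have hsum : ((∑ b ∈ W, ∑ i ∈ F, ‖∑ k ∈ Finset.range R, expChar (k * (x b - f i))‖ ^ 2 : ℝ) : ℂ) =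
      ∑ i ∈ Finset.range R, ∑ j ∈ Finset.range R, g ((i:ℝ) - j) := by
    simp only [Complex.ofReal_sum, ofReal_norm_geom_expChar_sq]
    calc _ = ∑ b ∈ W, ∑ i ∈ Finset.range R, ∑ j ∈ Finset.range R, ∑ l ∈ F,
          expChar (((i:ℝ) - j) * (x b - f l)) := by
          refine Finset.sum_congr rfl fun b _ => ?_
          rw [Finset.sum_comm]
          refine Finset.sum_congr rfl fun i _ => ?_
          rw [Finset.sum_comm]
      _ = _ := by
          rw [Finset.sum_comm]
          refine Finset.sum_congr rfl fun i _ => ?_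
          rw [Finset.sum_comm]
          refine Finset.sum_congr rfl fun j _ => ?_
          rw [hg]; simp only
          rw [Finset.sum_mul_sum]
          refine Finset.sum_congr rfl fun b _ => Finset.sum_congr rfl fun l _ => ?_
          rw [← expChar_add]; congr 1; ring
  have hrow : ∀ i ∈ Finset.range R,
      ‖∑ j ∈ Finset.range R, g ((i:ℝ) - j) - W.card * F.card‖ ≤
        2 * ∑ ξ ∈ Finset.Ioo 0 R, G ξ := by
    intro i hi
    have hiR := Finset.mem_range.1 hi
    rw [← Finset.add_sum_erase _ _ hi, sub_self, hg0, add_sub_cancel_left]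
    have hsplit : (Finset.range R).erase i = Finset.range i ∪ Finset.Ioo i R := by
      ext j; simp only [Finset.mem_erase, Finset.mem_range, Finset.mem_union, Finset.mem_Ioo]; omega
    have hdisj : Disjoint (Finset.range i) (Finset.Ioo i R) := by
      rw [Finset.disjoint_left]; intro j; simp only [Finset.mem_range, Finset.mem_Ioo]; omega
    have hGnn : ∀ ξ ∈ Finset.Ioo 0 R, 0 ≤ G ξ := fun ξ h =>
      (norm_nonneg _).trans (hgn ξ (Finset.mem_Ioo.1 h).1 (Finset.mem_Ioo.1 h).2)
    rw [hsplit, Finset.sum_union hdisj]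
    refine (norm_add_le _ _).trans ?_
    rw [two_mul]
    refine add_le_add ((norm_sum_le _ _).trans ?_) ((norm_sum_le _ _).trans ?_)
    · calc ∑ j ∈ Finset.range i, ‖g ((i:ℝ) - j)‖ ≤ ∑ j ∈ Finset.range i, G (i - j) := by
            refine Finset.sum_le_sum fun j hj => ?_
            have hj' := Finset.mem_range.1 hj
            rw [← Nat.cast_sub hj'.le]
            exact hgn _ (by omega) (by omega)
        _ = ∑ ξ ∈ (Finset.range i).image (fun j => i - j), G ξ := by
            rw [Finset.sum_image]
            intro a ha b hb hab
            simp only [Finset.coe_range, Set.mem_Iio] at ha hb hab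
            omega
        _ ≤ _ := by
            refine Finset.sum_le_sum_of_subset_of_nonneg ?_ fun ξ h _ => hGnn ξ h
            intro ξ hξ
            simp only [Finset.mem_image, Finset.mem_range, Finset.mem_Ioo] at hξ ⊢
            obtain ⟨a, ha, rfl⟩ := hξ; omega
    · calc ∑ j ∈ Finset.Ioo i R, ‖g ((i:ℝ) - j)‖ ≤ ∑ j ∈ Finset.Ioo i R, G (j - i) := by
            refine Finset.sum_le_sum fun j hj => ?_
            have hj' := Finset.mem_Ioo.1 hj
            rw [← neg_sub, ← Nat.cast_sub hj'.1.le]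
            exact hgn' _ (by omega) (by omega)
        _ = ∑ ξ ∈ (Finset.Ioo i R).image (fun j => j - i), G ξ := by
            rw [Finset.sum_image]
            intro a ha b hb hab
            simp only [Finset.coe_Ioo, Set.mem_Ioo] at ha hb hab
            omega
        _ ≤ _ := by
            refine Finset.sum_le_sum_of_subset_of_nonneg ?_ fun ξ h _ => hGnn ξ h
            intro ξ hξ
            simp only [Finset.mem_image, Finset.mem_Ioo] at hξ ⊢
            obtain ⟨a, ha, rfl⟩ := hξ; omega
  set T := ∑ b ∈ W, ∑ i ∈ F, ‖∑ k ∈ Finset.range R, expChar (k * (x b - f i))‖ ^ 2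
  have hfin : ‖(T:ℂ) - (R:ℝ) * (W.card * F.card)‖ ≤ 2 * R * ∑ ξ ∈ Finset.Ioo 0 R, G ξ := by
    have : (T:ℂ) - (R:ℝ) * (W.card * F.card) =
        ∑ i ∈ Finset.range R, (∑ j ∈ Finset.range R, g ((i:ℝ) - j) - W.card * F.card) := by
      rw [hsum, Finset.sum_sub_distrib]; simp
    rw [this]
    refine (norm_sum_le _ _).trans ((Finset.sum_le_sum hrow).trans_eq ?_)
    simp; ring
  have h2 : ‖(((R:ℝ) * (W.card * F.card) - T : ℝ) : ℂ)‖ ≤ 2 * R * ∑ ξ ∈ Finset.Ioo 0 R, G ξ := by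
    rw [← norm_neg]; refine le_of_eq_of_le ?_ hfin; congr 1; push_cast; ring
  rw [Complex.norm_real] at h2
  linarith [le_abs_self ((R:ℝ) * (W.card * F.card) - T),
    Real.norm_eq_abs ((R:ℝ) * (W.card * F.card) - T)]

/-- Sums over separated points are bounded by sums over bins. -/
theorem sum_floor_le {ι : Type*} (F : Finset ι) (φ : ι → ℝ) (Q : ℕ)
    (h0 : ∀ i ∈ F, 0 ≤ φ i) (h1 : ∀ i ∈ F, φ i ≤ 1)
    (hsep : ∀ i ∈ F, ∀ j ∈ F, i ≠ j → 1 ≤ |Q * φ i - Q * φ j|) (H K : ℝ) (hH : 0 ≤ H) (hK : 0 ≤ K) :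
    ∑ i ∈ F, (if ⌊Q * φ i⌋₊ = 0 then H else K / (⌊Q * φ i⌋₊ : ℝ) ^ 2) ≤ H + 2 * K := by
  set h : ℕ → ℝ := fun j => if j = 0 then H else K / (j : ℝ) ^ 2
  have hh : ∀ j, 0 ≤ h j := fun j => by
    simp only [h]; split_ifs; exacts [hH, by positivity]
  have hinj : Set.InjOn (fun i => ⌊Q * φ i⌋₊) (F : Set ι) := by
    intro i hi j hj hij
    by_contra hne
    have h2 := hsep i hi j hj hne
    have a1 := Nat.floor_le (mul_nonneg (Nat.cast_nonneg Q) (h0 i hi))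
    have a2 := Nat.lt_floor_add_one (Q * φ i)
    have a3 := Nat.floor_le (mul_nonneg (Nat.cast_nonneg Q) (h0 j hj))
    have a4 := Nat.lt_floor_add_one (Q * φ j)
    simp only at hij
    rw [hij] at a1 a2
    rcases le_abs.1 h2 with h3 | h3 <;> linarith
  calc _ = ∑ j ∈ F.image (fun i => ⌊Q * φ i⌋₊), h j := (Finset.sum_image hinj).symm
    _ ≤ ∑ j ∈ Finset.range (Q + 1), h j := by
        refine Finset.sum_le_sum_of_subset_of_nonneg ?_ fun j _ _ => hh j
        intro j hj
        obtain ⟨i, hi, rfl⟩ := Finset.mem_image.1 hj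
        rw [Finset.mem_range, Nat.lt_succ_iff]
        refine Nat.floor_le_of_le ?_
        exact mul_le_of_le_one_right (Nat.cast_nonneg _) (h1 i hi)
    _ ≤ ∑ j ∈ Finset.range (Q + 2), h j := by
        refine Finset.sum_le_sum_of_subset_of_nonneg ?_ fun j _ _ => hh j
        exact Finset.range_subset_range.2 (by omega)
    _ ≤ H + K * (2 - 1 / (Q + 1)) := by
        clear hsep hinj
        induction Q with
        | zero => simp [Finset.sum_range_succ, h]; linarith
        | succ Q ih =>
          rw [Finset.sum_range_succ]
          have h3 : h (Q + 2) = K / ((Q:ℝ) + 2) ^ 2 := by simp [h]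
          have h4 : K * (1 / ((Q:ℝ) + 2) ^ 2) ≤ K * (1 / (Q + 1) - 1 / (Q + 1 + 1)) := by
            refine mul_le_mul_of_nonneg_left ?_ hK
            rw [div_sub_div _ _ (by positivity) (by positivity),
              div_le_div_iff₀ (by positivity) (by positivity)]
            nlinarith [(Nat.cast_nonneg Q : (0:ℝ) ≤ Q)]
          rw [h3]; push_cast
          have h5 : K / ((Q:ℝ) + 2) ^ 2 = K * (1 / ((Q:ℝ) + 2) ^ 2) := by ring
          linarith
    _ ≤ H + 2 * K := by
        have : 0 ≤ K * (1 / ((Q:ℝ) + 1)) := by positivity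
        linarith

theorem sum_expChar_natCast_mul_fract (R : ℕ) (x : ℝ) :
    ∑ k ∈ Finset.range R, expChar (k * Int.fract x) = ∑ k ∈ Finset.range R, expChar (k * x) := by
  simp only [expChar_natCast_mul, expChar_fract]

theorem norm_geom_expChar_sq_le (R : ℕ) {x : ℝ} (h0 : 0 < x) (h1 : x < 1) :
    ‖∑ k ∈ Finset.range R, expChar (k * x)‖ ^ 2 ≤ 1 / 2 / x ^ 2 + 1 / 2 / (1 - x) ^ 2 := by
  have h := pow_le_pow_left₀ (norm_nonneg _) (norm_geom_expChar_le R h0 h1) 2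
  refine h.trans ?_
  have e1 : 1 / 2 / x ^ 2 = (1 / x) ^ 2 / 2 := by ring
  have e2 : 1 / 2 / (1 - x) ^ 2 = (1 / (1 - x)) ^ 2 / 2 := by
    rw [div_pow, div_div, one_pow, div_div, mul_comm]
  rw [e1, e2]
  nlinarith [sq_nonneg (1 / x - 1 / (1 - x))]

/-- Fejér sums over separated points. -/
theorem sum_fejer_le {ι : Type*} (R Q : ℕ) (x : ℝ) (F : Finset ι) (f : ι → ℝ)
    (hsep : ∀ i ∈ F, ∀ j ∈ F, i ≠ j → ∀ z : ℤ, 1 ≤ Q * |f i - f j - z|) {H : ℝ}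
    (hH0 : 0 ≤ H) (hH : ∀ i ∈ F, ‖∑ k ∈ Finset.range R, expChar (k * (x - f i))‖ ^ 2 ≤ H) :
    ∑ i ∈ F, ‖∑ k ∈ Finset.range R, expChar (k * (x - f i))‖ ^ 2 ≤ 2 * H + 2 * (Q:ℝ) ^ 2 := by
  have hsep' : ∀ i ∈ F, ∀ j ∈ F, i ≠ j →
      1 ≤ |Q * Int.fract (x - f i) - Q * Int.fract (x - f j)| := by
    intro i hi j hj hij
    have h := hsep i hi j hj hij (⌊x - f j⌋ - ⌊x - f i⌋)
    rw [← mul_sub, abs_mul, Nat.abs_cast, abs_sub_comm]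
    refine h.trans_eq ?_
    congr 2
    rw [Int.fract, Int.fract]; push_cast; ring
  have hb1 := sum_floor_le F (fun i => Int.fract (x - f i)) Q (fun i _ => Int.fract_nonneg _)
    (fun i _ => (Int.fract_lt_one _).le) hsep' H ((Q:ℝ) ^ 2 / 2) hH0 (by positivity)
  have hb2 := sum_floor_le F (fun i => 1 - Int.fract (x - f i)) Q
    (fun i _ => sub_nonneg.2 (Int.fract_lt_one _).le)
    (fun i _ => sub_le_self _ (Int.fract_nonneg _)) (fun i hi j hj hij => by
      have h := hsep' j hj i hi hij.symm
      refine h.trans_eq ?_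
      congr 1; ring) H ((Q:ℝ) ^ 2 / 2) hH0 (by positivity)
  have key : ∀ {y : ℝ} {N : ℕ}, N = ⌊Q * y⌋₊ → 0 < N → 0 ≤ y →
      0 < y ∧ 1 / 2 / y ^ 2 ≤ (Q:ℝ) ^ 2 / 2 / (N:ℝ) ^ 2 := by
    intro y N hN hpos hy
    have hle : (N:ℝ) ≤ Q * y := hN ▸ Nat.floor_le (mul_nonneg (Nat.cast_nonneg _) hy)
    have hN0 : (0:ℝ) < N := by exact_mod_cast hpos
    have hy0 : 0 < y := by
      rcases hy.lt_or_eq with h | h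
      · exact h
      · rw [← h, mul_zero] at hle; linarith
    refine ⟨hy0, ?_⟩
    rw [div_div, div_div, div_le_div_iff₀ (by positivity) (by positivity)]
    nlinarith [pow_le_pow_left₀ hN0.le hle 2]
  calc _ ≤ ∑ i ∈ F, ((if ⌊Q * Int.fract (x - f i)⌋₊ = 0 then H else
        (Q:ℝ) ^ 2 / 2 / (⌊Q * Int.fract (x - f i)⌋₊ : ℝ) ^ 2) +
        if ⌊Q * (1 - Int.fract (x - f i))⌋₊ = 0 then H else
        (Q:ℝ) ^ 2 / 2 / (⌊Q * (1 - Int.fract (x - f i))⌋₊ : ℝ) ^ 2) := by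
        refine Finset.sum_le_sum fun i hi => ?_
        have h := hH i hi
        have nn : ∀ N : ℕ, 0 ≤ (if N = 0 then H else (Q:ℝ) ^ 2 / 2 / (N:ℝ) ^ 2) := by
          intro N; split_ifs; exacts [hH0, by positivity]
        have n1 := nn ⌊Q * Int.fract (x - f i)⌋₊
        have n2 := nn ⌊Q * (1 - Int.fract (x - f i))⌋₊
        by_cases z1 : ⌊Q * Int.fract (x - f i)⌋₊ = 0
        · rw [if_pos z1]; linarith
        by_cases z2 : ⌊Q * (1 - Int.fract (x - f i))⌋₊ = 0
        · rw [if_pos z2]; linarith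
        rw [if_neg z1, if_neg z2]
        obtain ⟨p1, k1⟩ := key rfl (Nat.pos_of_ne_zero z1) (Int.fract_nonneg _)
        obtain ⟨p2, k2⟩ := key rfl (Nat.pos_of_ne_zero z2)
          (sub_nonneg.2 (Int.fract_lt_one (x - f i)).le)
        rw [← sum_expChar_natCast_mul_fract]
        exact (norm_geom_expChar_sq_le R p1 (by linarith)).trans (add_le_add k1 k2)
    _ ≤ _ := by rw [Finset.sum_add_distrib]; linarith

/-- The reduced fractions `p / q ∈ [0, 1)` with denominator between `X / 4` and `X`. -/
def fareyFractions (X : ℕ) : Finset (Σ _ : ℕ, ℕ) :=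
  (fareyDenominators X).sigma fun q => (Finset.range q).filter q.Coprime

theorem mem_fareyFractions {X : ℕ} {i : Σ _ : ℕ, ℕ} : i ∈ fareyFractions X ↔
    (0 < i.1 ∧ i.1 ≤ X ∧ X < 4 * i.1) ∧ i.2 < i.1 ∧ i.1.Coprime i.2 := by
  simp [fareyFractions, fareyDenominators, and_assoc]

theorem le_card_fareyFractions (X : ℕ) : (X:ℝ) ^ 2 / 16 ≤ (fareyFractions X).card := by
  rw [fareyFractions, Finset.card_sigma, Nat.cast_sum]
  exact le_sum_totient X

theorem norm_sum_fareyFractions_le (ξ X : ℕ) (hξ : ξ ≠ 0) :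
    ‖∑ i ∈ fareyFractions X, expChar (ξ * ((i.2:ℝ) / i.1))‖ ≤ X * ξ.divisors.card := by
  rw [fareyFractions, Finset.sum_sigma]
  exact (norm_sum_le _ _).trans (sum_norm_ramanujanSum_le ξ X hξ)

theorem fareyFractions_separated {X : ℕ} {i j : Σ _ : ℕ, ℕ} (hi : i ∈ fareyFractions X)
    (hj : j ∈ fareyFractions X) (hij : i ≠ j) (z : ℤ) :
    1 ≤ ((X ^ 2 : ℕ) : ℝ) * |(i.2:ℝ) / i.1 - j.2 / j.1 - z| := by
  obtain ⟨q, p⟩ := i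
  obtain ⟨q', p'⟩ := j
  rw [mem_fareyFractions] at hi hj
  obtain ⟨⟨hq0, hqX, -⟩, hp, hc⟩ := hi
  obtain ⟨⟨hq0', hqX', -⟩, hp', hc'⟩ := hj
  simp only at *
  have hne : ((p * q' : ℤ) - p' * q - z * q * q') ≠ 0 := by
    intro h
    have d1 : (q:ℤ) ∣ q' := by
      have : (q:ℤ) ∣ p * q' := ⟨p' + z * q', by linear_combination h⟩
      exact (Nat.isCoprime_iff_coprime.2 hc).dvd_of_dvd_mul_left this
    have d2 : (q':ℤ) ∣ q := by
      have : (q':ℤ) ∣ p' * q := ⟨p - z * q, by linear_combination -h⟩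
      exact (Nat.isCoprime_iff_coprime.2 hc').dvd_of_dvd_mul_left this
    have hqq : q = q' :=
      Nat.dvd_antisymm (Int.natCast_dvd_natCast.1 d1) (Int.natCast_dvd_natCast.1 d2)
    subst hqq
    have hq : (q:ℤ) ≠ 0 := by exact_mod_cast hq0.ne'
    have h2 : (p:ℤ) - p' = z * q := by
      apply mul_right_cancel₀ hq; linear_combination h
    have hz : z = 0 := by
      have a1 : (p:ℤ) < q := by exact_mod_cast hp
      have a2 : (p':ℤ) < q := by exact_mod_cast hp'
      have a3 : (0:ℤ) < q := by exact_mod_cast hq0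
      by_contra hz
      rcases lt_or_gt_of_ne hz with h3 | h3 <;> nlinarith
    apply hij
    rw [hz] at h2
    have : p = p' := by omega
    rw [this]
  have h1 : (1:ℝ) ≤ |((p * q' : ℤ) - p' * q - z * q * q' : ℤ)| := by
    exact_mod_cast Int.one_le_abs hne
  have hq0R : (0:ℝ) < q := by exact_mod_cast hq0
  have hq0R' : (0:ℝ) < q' := by exact_mod_cast hq0'
  have e : (p:ℝ) / q - p' / q' - z = (((p * q' : ℤ) - p' * q - z * q * q' : ℤ) : ℝ) / (q * q') := by
    push_cast; field_simp
  rw [e, abs_div, abs_of_pos (mul_pos hq0R hq0R'), ← mul_div_assoc, le_div_iff₀ (by positivity)]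
  have hqXR : (q:ℝ) ≤ X := by exact_mod_cast hqX
  have hqXR' : (q':ℝ) ≤ X := by exact_mod_cast hqX'
  push_cast at h1 ⊢
  nlinarith [mul_le_mul hqXR hqXR' hq0R'.le (Nat.cast_nonneg X)]

/-- The words `b` such that the word `v` followed by `b` is, at scale `B ^ t`, close to a reduced
fraction with denominator about `B ^ t'`. -/
def nearWords (B : ℕ) (D : Finset ℕ) (v k t t' : ℕ) : Finset ℕ :=
  open scoped Classical in (digitWords B D k).filter fun b =>
    ∃ q ∈ fareyDenominators (B ^ t'), ∃ p : ℤ, IsCoprime p q ∧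
      |((v * B ^ k + b : ℕ) : ℝ) - B ^ t * (p / q)| ≤ 1

theorem mem_nearWords {B : ℕ} {D : Finset ℕ} {v k t t' b : ℕ} :
    b ∈ nearWords B D v k t t' ↔ b ∈ digitWords B D k ∧
      ∃ q ∈ fareyDenominators (B ^ t'), ∃ p : ℤ, IsCoprime p q ∧
        |((v * B ^ k + b : ℕ) : ℝ) - B ^ t * (p / q)| ≤ 1 := by
  classical exact Finset.mem_filter

/-- Words that are not near a fraction have a small Fejér sum. -/
theorem sum_fejer_le_of_notMem_nearWords {B : ℕ} (hB : 0 < B) {D : Finset ℕ} {v k t t' b : ℕ}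
    (hb : b ∈ digitWords B D k) (hnear : b ∉ nearWords B D v k t t') (R : ℕ) :
    ∑ i ∈ fareyFractions (B ^ t'), ‖∑ k' ∈ Finset.range R,
      expChar (k' * (((v * B ^ k + b : ℕ) : ℝ) / B ^ t - i.2 / i.1))‖ ^ 2 ≤
      2 * ((B:ℝ) ^ t) ^ 2 + 2 * (((B ^ t') ^ 2 : ℕ) : ℝ) ^ 2 := by
  have hBR : (0:ℝ) < B := by exact_mod_cast hB
  have hBt : (0:ℝ) < (B:ℝ) ^ t := pow_pos hBR t
  refine sum_fejer_le R ((B ^ t') ^ 2) (((v * B ^ k + b : ℕ) : ℝ) / B ^ t) _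
    (fun i : (Σ _ : ℕ, ℕ) => (i.2:ℝ) / i.1)
    (fun i hi j hj hij z => fareyFractions_separated hi hj hij z) (sq_nonneg _) fun i hi => ?_
  obtain ⟨q, p⟩ := i
  rw [mem_fareyFractions] at hi
  obtain ⟨hq, hp, hc⟩ := hi
  simp only at hq hp hc ⊢
  have hq0 : (0:ℝ) < q := by exact_mod_cast hq.1
  set w : ℝ := ((v * B ^ k + b : ℕ) : ℝ) with hw
  set x : ℝ := w / B ^ t - p / q with hx
  have hfar : ∀ z : ℤ, 1 < |x - z| * (B:ℝ) ^ t := by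
    intro z
    by_contra hle
    apply hnear
    rw [mem_nearWords]
    refine ⟨hb, q, ?_, p + z * q, ?_, ?_⟩
    · rw [fareyDenominators, Finset.mem_filter, Finset.mem_Ioc]; exact ⟨⟨hq.1, hq.2.1⟩, hq.2.2⟩
    · exact (IsCoprime.add_mul_right_left_iff).2 (Nat.isCoprime_iff_coprime.2 hc.symm)
    · rw [← hw]
      rw [not_lt, ← abs_of_pos hBt, ← abs_mul] at hle
      refine le_of_eq_of_le ?_ hle
      congr 1
      rw [hx]; push_cast; field_simp; ring
  rw [← sum_expChar_natCast_mul_fract]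
  have f1 := hfar ⌊x⌋
  have f2 := hfar (⌊x⌋ + 1)
  have e1 : x - ⌊x⌋ = Int.fract x := rfl
  have e2 : x - ((⌊x⌋ + 1 : ℤ) : ℝ) = -(1 - Int.fract x) := by rw [Int.fract]; push_cast; ring
  rw [e1, abs_of_nonneg (Int.fract_nonneg _)] at f1
  rw [e2, abs_neg, abs_of_nonneg (sub_nonneg.2 (Int.fract_lt_one x).le)] at f2
  have p1 : 0 < Int.fract x := by
    by_contra h; have := mul_nonpos_of_nonpos_of_nonneg (not_lt.1 h) hBt.le; linarith
  have p2 : Int.fract x < 1 := Int.fract_lt_one x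
  refine (norm_geom_expChar_sq_le R p1 p2).trans ?_
  have inv : ∀ y : ℝ, 0 < y → 1 < y * (B:ℝ) ^ t → 1 / 2 / y ^ 2 ≤ ((B:ℝ) ^ t) ^ 2 / 2 := by
    intro y hy h
    rw [div_div, div_le_div_iff₀ (by positivity) (by norm_num)]
    have : 1 ≤ (y * (B:ℝ) ^ t) ^ 2 := one_le_pow₀ h.le
    rw [mul_pow] at this
    nlinarith
  have := inv _ p1 f1
  have := inv _ (sub_pos.2 p2) f2
  linarith

theorem le_of_fejer_bounds {N d A b X Φ G : ℝ} (hd : 0 < d) (hA : 0 < A) (hb : 1 ≤ b)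
    (hAb : 1000 * b ^ 2 ≤ A) (hX : 0 < X) (hΦ : X ^ 2 / 16 ≤ Φ) (hG : G ≤ d * X ^ 2 / 64)
    (h : A * X ^ 2 * (d * Φ) - 2 * (A * X ^ 2) * G ≤
      N * (2 * (A * X ^ 2) ^ 2 + 2 * (X ^ 2) ^ 2) + d * (2 * (X ^ 2 * b) ^ 2 + 2 * (X ^ 2) ^ 2)) :
    A / 64 / (2 * A ^ 2 + 2) * d ≤ N := by
  have l1 : A * X ^ 2 * (d * (X ^ 2 / 16)) ≤ A * X ^ 2 * (d * Φ) := by gcongr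
  have l2 : 2 * (A * X ^ 2) * G ≤ 2 * (A * X ^ 2) * (d * X ^ 2 / 64) := by gcongr
  have l4 : X ^ 4 * d * (2 * b ^ 2 + 2) ≤ X ^ 4 * d * (A / 64) := by
    refine mul_le_mul_of_nonneg_left ?_ (by positivity)
    nlinarith
  have l3 : X ^ 4 * (d * A / 64) ≤ X ^ 4 * (N * (2 * A ^ 2 + 2)) := by linarith
  have l5 := le_of_mul_le_mul_left l3 (by positivity)
  rw [div_mul_eq_mul_div, div_le_iff₀ (by positivity)]
  linarith

theorem exists_card_nearWords_ge {B : ℕ} (hB : 10 ≤ B) {D : Finset ℕ} (hD : ∀ d ∈ D, d < B)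
    (hne : D.Nonempty) {γ : ℝ} (hγ : γ ^ 12 ≤ B)
    (hC : ∀ θ : ℝ, ∑ r ∈ Finset.range B, ‖∑ d ∈ D, expChar (d * (θ + r / B))‖ ≤ D.card * γ)
    (s : ℕ) : ∃ c : ℝ, 0 < c ∧ ∀ τ v : ℕ, ∀ᶠ t' in atTop,
      c * (D.card : ℝ) ^ (2 * t' + s - τ) ≤
        (nearWords B D v (2 * t' + s - τ) (2 * t' + s) t').card := by
  have hBR : (10:ℝ) ≤ B := by exact_mod_cast hB
  have hB0 : (0:ℝ) < B := by linarith
  have hDc : (0:ℝ) < D.card := by exact_mod_cast hne.card_pos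
  set A : ℝ := (B:ℝ) ^ (2 * s + 3) with hA
  have hA0 : 0 < A := by positivity
  refine ⟨A / 64 / (2 * A ^ 2 + 2), by positivity, fun τ v => ?_⟩
  set K : ℝ := 64 * (B:ℝ) ^ (s + 3) * (B:ℝ) ^ τ with hK
  have hev : ∀ᶠ t' : ℕ in atTop,
      K ^ 12 * (8 ^ 32 * (B:ℝ) ^ (8 * s + 12)) * (B:ℝ) ^ s ≤ (B:ℝ) ^ t' :=
    (tendsto_pow_atTop_atTop_of_one_lt (by linarith : (1:ℝ) < B)).eventually_ge_atTop _
  filter_upwards [hev, eventually_ge_atTop τ] with t' hbig hτ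
  obtain ⟨k, hk⟩ : ∃ k, 2 * t' + s = k + τ := ⟨2 * t' + s - τ, by omega⟩
  rw [show 2 * t' + s - τ = k by omega, hk]
  set X : ℕ := B ^ t' with hX
  have hXR : (X:ℝ) = (B:ℝ) ^ t' := by rw [hX]; push_cast; rfl
  have hX1 : (1:ℝ) ≤ X := by rw [hXR]; exact one_le_pow₀ (by linarith)
  set R : ℕ := B ^ (s + 3) * (B ^ k * B ^ τ) with hR
  have hBt : (B:ℝ) ^ (k + τ) = (X:ℝ) ^ 2 * (B:ℝ) ^ s := by
    rw [← hk, hXR, ← pow_mul, ← pow_add]; congr 1; ring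
  have hRR : (R:ℝ) = A * (X:ℝ) ^ 2 := by
    rw [hR]; push_cast
    rw [← pow_add (B:ℝ) k τ, hBt, hA, show 2 * s + 3 = (s + 3) + s by ring, pow_add]
    ring
  set W := digitWords B D k with hW
  have hWc : (W.card : ℝ) = (D.card : ℝ) ^ k := by
    rw [hW, card_digitWords hD]; push_cast; rfl
  set F := fareyFractions X with hF
  set x : ℕ → ℝ := fun b => ((v * B ^ k + b : ℕ) : ℝ) / B ^ (k + τ) with hx
  set E : ℕ → ℝ := fun b => ∑ i ∈ F, ‖∑ k' ∈ Finset.range R,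
      expChar (k' * (x b - i.2 / i.1))‖ ^ 2 with hE
  set Nr := nearWords B D v k (k + τ) t' with hNr
  have hNW : Nr ⊆ W := by exact fun b hb => (mem_nearWords.1 hb).1
  -- upper bound
  have hup_all : ∀ b, E b ≤ 2 * (R:ℝ) ^ 2 + 2 * ((X ^ 2 : ℕ) : ℝ) ^ 2 := by
    intro b
    refine sum_fejer_le R (X ^ 2) (x b) F (fun i : (Σ _ : ℕ, ℕ) => (i.2:ℝ) / i.1)
      (fun i hi j hj hij z => fareyFractions_separated hi hj hij z) (sq_nonneg _) fun i _ => ?_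
    refine pow_le_pow_left₀ (norm_nonneg _) ?_ 2
    simpa using norm_sum_expChar_le (Finset.range R) (x b - (i.2:ℝ) / i.1)
  have hup_far : ∀ b ∈ W \ Nr, E b ≤ 2 * ((B:ℝ) ^ (k + τ)) ^ 2 + 2 * ((X ^ 2 : ℕ) : ℝ) ^ 2 := by
    intro b hb
    rw [Finset.mem_sdiff] at hb
    exact sum_fejer_le_of_notMem_nearWords (by omega) hb.1 hb.2 R
  have hupper : ∑ b ∈ W, E b ≤ Nr.card * (2 * (R:ℝ) ^ 2 + 2 * ((X ^ 2 : ℕ) : ℝ) ^ 2) +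
      W.card * (2 * ((B:ℝ) ^ (k + τ)) ^ 2 + 2 * ((X ^ 2 : ℕ) : ℝ) ^ 2) := by
    rw [← Finset.sum_sdiff hNW, add_comm]
    refine add_le_add ?_ ?_
    · refine (Finset.sum_le_sum fun b _ => hup_all b).trans_eq ?_
      rw [Finset.sum_const, nsmul_eq_mul]
    · refine (Finset.sum_le_sum hup_far).trans ?_
      rw [Finset.sum_const, nsmul_eq_mul]
      refine mul_le_mul_of_nonneg_right ?_ (by positivity)
      exact_mod_cast Finset.card_le_card Finset.sdiff_subset
  -- lower bound
  set P : ℝ := (8 ^ 8 * (R:ℝ)) ^ (3⁻¹ : ℝ) with hP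
  have hP0 : 0 ≤ P := by positivity
  have hP3 : P ^ 3 = 8 ^ 8 * (R:ℝ) := by
    rw [hP, ← Real.rpow_natCast, ← Real.rpow_mul (by positivity)]; norm_num
  have hdiv : ∀ ξ : ℕ, 0 < ξ → ξ < R → (ξ.divisors.card : ℝ) ≤ P := by
    intro ξ h0 h1
    refine le_of_pow_le_pow_left₀ (n := 3) (by norm_num) hP0 ?_
    rw [hP3]
    have := card_divisors_pow_three_le h0.ne'
    calc ((ξ.divisors.card : ℝ)) ^ 3 ≤ 8 ^ 8 * (ξ:ℝ) := by exact_mod_cast this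
      _ ≤ 8 ^ 8 * (R:ℝ) := by
        have : (ξ:ℝ) ≤ R := by exact_mod_cast h1.le
        linarith
  have hphase : ∀ ξ : ℕ, ‖∑ b ∈ W, expChar (ξ * x b)‖ = wordSum B D k (ξ / (B:ℝ) ^ (k + τ)) := by
    intro ξ
    have : ∀ b, expChar (ξ * x b) = expChar (ξ * ((v * B ^ k : ℕ) / (B:ℝ) ^ (k + τ))) *
        expChar (b * (ξ / (B:ℝ) ^ (k + τ))) := by
      intro b; rw [← expChar_add, hx]; congr 1; push_cast; ring
    simp only [this]
    rw [← Finset.mul_sum, norm_mul, norm_expChar, one_mul, wordSum]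
  have hlower := sum_fejer_ge R W x F (fun i => (i.2:ℝ) / i.1)
    (fun ξ => wordSum B D k (ξ / (B:ℝ) ^ (k + τ)) * (X * P)) (by
      intro ξ h0 h1
      rw [hphase]
      refine mul_le_mul_of_nonneg_left ?_ (norm_nonneg _)
      exact (norm_sum_fareyFractions_le ξ X h0.ne').trans
        (mul_le_mul_of_nonneg_left (hdiv ξ h0 h1) (Nat.cast_nonneg _)))
  have hGsum : ∑ ξ ∈ Finset.Ioo 0 R, wordSum B D k (ξ / (B:ℝ) ^ (k + τ)) * (X * P) ≤
      (B:ℝ) ^ (s + 3) * ((B:ℝ) ^ τ * (D.card * γ) ^ k) * (X * P) := by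
    rw [← Finset.sum_mul]
    refine mul_le_mul_of_nonneg_right ?_ (by positivity)
    refine (Finset.sum_le_sum_of_subset_of_nonneg (t := Finset.range R) ?_
      fun _ _ _ => norm_nonneg _).trans ?_
    · intro ξ h; rw [Finset.mem_Ioo] at h; exact Finset.mem_range.2 h.2
    · have := sum_wordSum_range_le (by omega : 0 < B) hD hC k τ (B ^ (s + 3))
      push_cast at this; exact this
  have herr : K * (P * γ ^ k) ≤ X := by
    refine le_of_pow_le_pow_left₀ (n := 12) (by norm_num) (by positivity) ?_
    have hγk : (γ ^ k) ^ 12 ≤ (X:ℝ) ^ 2 * (B:ℝ) ^ s := by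
      rw [← hBt, ← pow_mul, mul_comm, pow_mul]
      exact (pow_le_pow_left₀ (by positivity) hγ k).trans
        (pow_le_pow_right₀ (by linarith) (by omega))
    have hP12 : P ^ 12 = 8 ^ 32 * (B:ℝ) ^ (8 * s + 12) * (X:ℝ) ^ 8 := by
      rw [show 12 = 3 * 4 by norm_num, pow_mul, hP3, hRR, hA, mul_pow, mul_pow, ← pow_mul,
        ← pow_mul, ← pow_mul]
      ring
    calc (K * (P * γ ^ k)) ^ 12 = K ^ 12 * P ^ 12 * (γ ^ k) ^ 12 := by ring
      _ ≤ K ^ 12 * P ^ 12 * ((X:ℝ) ^ 2 * (B:ℝ) ^ s) :=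
          mul_le_mul_of_nonneg_left hγk (by positivity)
      _ = K ^ 12 * (8 ^ 32 * (B:ℝ) ^ (8 * s + 12)) * (B:ℝ) ^ s * (X:ℝ) ^ 10 := by rw [hP12]; ring
      _ ≤ X * (X:ℝ) ^ 10 := by
          rw [← hXR] at hbig
          exact mul_le_mul_of_nonneg_right hbig (by positivity)
      _ ≤ X * (X:ℝ) ^ 11 := by
          refine mul_le_mul_of_nonneg_left (pow_le_pow_right₀ hX1 (by norm_num)) (by positivity)
      _ = (X:ℝ) ^ 12 := by ring
  have hcard := le_card_fareyFractions X
  rw [← hF] at hcard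
  set d := (D.card : ℝ) ^ k with hd
  have hd0 : 0 < d := by positivity
  set b := (B:ℝ) ^ s with hb
  have hb1 : 1 ≤ b := one_le_pow₀ (by linarith)
  have hAb : 1000 * b ^ 2 ≤ A := by
    have : A = (B:ℝ) ^ 3 * b ^ 2 := by rw [hA, hb, pow_add, pow_mul]; ring
    rw [this]
    refine mul_le_mul_of_nonneg_right ?_ (by positivity)
    calc (1000:ℝ) = 10 ^ 3 := by norm_num
      _ ≤ _ := pow_le_pow_left₀ (by norm_num) hBR 3
  have hG2 : ∑ ξ ∈ Finset.Ioo 0 R, wordSum B D k (ξ / (B:ℝ) ^ (k + τ)) * (X * P) ≤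
      d * (X:ℝ) ^ 2 / 64 := by
    refine hGsum.trans ?_
    calc _ = d * X / 64 * (K * (P * γ ^ k)) := by rw [mul_pow, hK, hd]; ring
      _ ≤ d * X / 64 * X := mul_le_mul_of_nonneg_left herr (by positivity)
      _ = _ := by ring
  set Gs := ∑ ξ ∈ Finset.Ioo 0 R, wordSum B D k (ξ / (B:ℝ) ^ (k + τ)) * (X * P)
  have hmain := hlower.trans hupper
  rw [hWc, hRR, hBt] at hmain
  push_cast at hmain
  exact le_of_fejer_bounds hd0 hA0 hb1 hAb (by linarith) hcard hG2 hmain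

theorem exists_constant_word {B : ℕ} {D : Finset ℕ} {d : ℕ} (hd : d ∈ D) (l : ℕ) :
    ∃ w ∈ digitWords B D l, (w : ℤ) = d * ∑ i ∈ Finset.range l, (B:ℤ) ^ i := by
  induction l with
  | zero => exact ⟨0, by simp [digitWords], by simp⟩
  | succ l ih =>
    obtain ⟨w, hw, h⟩ := ih
    refine ⟨B * w + d, mem_digitWords_succ.2 ⟨w, hw, d, hd, rfl⟩, ?_⟩
    rw [Finset.sum_range_succ', mul_add]
    push_cast
    rw [h]
    simp only [pow_succ, ← Finset.sum_mul]; ring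

theorem exists_word_single_digit {B : ℕ} {D : Finset ℕ} {d d' : ℕ} (hd : d ∈ D) (hd' : d' ∈ D)
    {j l : ℕ} (hj : j < l) : ∃ w ∈ digitWords B D l,
      (w : ℤ) = d * ∑ i ∈ Finset.range l, (B:ℤ) ^ i + (d' - d) * (B:ℤ) ^ j := by
  induction j generalizing l with
  | zero =>
    obtain ⟨l, rfl⟩ := Nat.exists_eq_add_one_of_ne_zero hj.ne'
    obtain ⟨w, hw, h⟩ := exists_constant_word (B := B) hd l
    refine ⟨B * w + d', mem_digitWords_succ.2 ⟨w, hw, d', hd', rfl⟩, ?_⟩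
    rw [Finset.sum_range_succ', mul_add]
    push_cast
    rw [h]
    simp only [pow_succ, ← Finset.sum_mul]; ring
  | succ j ih =>
    obtain ⟨l, rfl⟩ := Nat.exists_eq_add_one_of_ne_zero (by omega : l ≠ 0)
    obtain ⟨w, hw, h⟩ := ih (l := l) (by omega)
    refine ⟨B * w + d, mem_digitWords_succ.2 ⟨w, hw, d, hd, rfl⟩, ?_⟩
    rw [Finset.sum_range_succ', mul_add]
    push_cast
    rw [h]
    simp only [pow_succ, ← Finset.sum_mul]; ring

theorem exists_ne_abs_fract_sub_lt (x : ℕ → ℝ) {η : ℝ} (hη : 0 < η) :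
    ∃ i j : ℕ, i ≠ j ∧ |Int.fract (x i) - Int.fract (x j)| < η := by
  obtain ⟨a, -, φ, hφ, hlim⟩ := (isCompact_Icc (a := (0:ℝ)) (b := 1)).tendsto_subseq
    (x := fun i => Int.fract (x i)) fun i => ⟨Int.fract_nonneg _, (Int.fract_lt_one _).le⟩
  obtain ⟨N, hN⟩ := Metric.cauchySeq_iff.1 hlim.cauchySeq η hη
  exact ⟨φ N, φ (N + 1), (hφ (Nat.lt_succ_self N)).ne, hN N le_rfl (N + 1) (by omega)⟩

/-- Two words of the same length whose values differ, modulo one, by a small but not too small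
multiple of an irrational number. -/
theorem exists_words_small_shift {B : ℕ} (hB : 2 ≤ B) {D : Finset ℕ} {d d' : ℕ} (hd : d ∈ D)
    (hd' : d' ∈ D) (hne : d ≠ d') {μ : ℝ} (hμ : Irrational μ) {η : ℝ} (hη : 0 < η) :
    ∃ l : ℕ, ∃ x ∈ digitWords B D l, ∃ y ∈ digitWords B D l, ∃ z : ℤ,
      η / B ≤ μ * ((y:ℝ) - x) - z ∧ μ * ((y:ℝ) - x) - z ≤ η := by
  have hBR : (2:ℝ) ≤ B := by exact_mod_cast hB
  have hB0 : (0:ℝ) < B := by linarith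
  set α : ℝ := μ * ((d':ℝ) - d) with hα
  have hαi : Irrational α := by
    have : α = μ * (((d':ℤ) - d : ℤ) : ℝ) := by rw [hα]; push_cast; rfl
    rw [this]; exact hμ.mul_intCast (by omega)
  obtain ⟨i, j, hij, hlt⟩ := exists_ne_abs_fract_sub_lt (fun i => α * (B:ℝ) ^ i) hη
  set r : ℝ := Int.fract (α * (B:ℝ) ^ j) - Int.fract (α * (B:ℝ) ^ i) with hr
  obtain ⟨z, hz⟩ : ∃ z : ℤ, r = α * ((B:ℝ) ^ j - (B:ℝ) ^ i) - z :=
    ⟨⌊α * (B:ℝ) ^ j⌋ - ⌊α * (B:ℝ) ^ i⌋, by rw [hr, Int.fract, Int.fract]; push_cast; ring⟩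
  have hr0 : r ≠ 0 := by
    have h1 : ((B:ℤ) ^ j - (B:ℤ) ^ i) ≠ 0 := by
      intro h
      have : (B:ℤ) ^ j = (B:ℤ) ^ i := by linarith
      have : B ^ j = B ^ i := by exact_mod_cast this
      exact hij (Nat.pow_right_injective hB this).symm
    have h2 := (hαi.mul_intCast h1).ne_int z
    intro h
    rw [hz] at h
    apply h2; push_cast; linarith
  have hrη : |r| ≤ η := by rw [hr, abs_sub_comm]; exact hlt.le
  have hrp : 0 < |r| := abs_pos.2 hr0
  obtain ⟨n, hn1, hn2⟩ := exists_nat_pow_near ((one_le_div hrp).2 hrη) (by linarith : (1:ℝ) < B)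
  rw [le_div_iff₀ hrp] at hn1
  rw [div_lt_iff₀ hrp, pow_succ] at hn2
  have hn3 : η / B ≤ (B:ℝ) ^ n * |r| := by rw [div_le_iff₀ hB0]; linarith
  obtain ⟨x, hx, hxe⟩ :=
    exists_word_single_digit (B := B) hd hd' (show i + n < i + j + n + 1 by omega)
  obtain ⟨y, hy, hye⟩ :=
    exists_word_single_digit (B := B) hd hd' (show j + n < i + j + n + 1 by omega)
  have hdiff : μ * ((y:ℝ) - x) = (B:ℝ) ^ n * (r + z) := by
    have e1 : (y:ℤ) - x = (d' - d) * ((B:ℤ) ^ (j + n) - (B:ℤ) ^ (i + n)) := by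
      rw [hxe, hye]; ring
    have e2 : (y:ℝ) - x = (d' - d) * ((B:ℝ) ^ (j + n) - (B:ℝ) ^ (i + n)) := by exact_mod_cast e1
    rw [e2, hz, hα]; ring
  rcases lt_or_gt_of_ne hr0 with h | h
  · rw [abs_of_neg h] at hn1 hn3
    refine ⟨_, y, hy, x, hx, -(B ^ n * z), ?_⟩
    have : μ * ((x:ℝ) - y) - ((-(B ^ n * z) : ℤ) : ℝ) = (B:ℝ) ^ n * -r := by
      push_cast; linear_combination -hdiff
    rw [this]; exact ⟨hn3, hn1⟩
  · rw [abs_of_pos h] at hn1 hn3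
    refine ⟨_, x, hx, y, hy, B ^ n * z, ?_⟩
    have : μ * ((y:ℝ) - x) - ((B ^ n * z : ℤ) : ℝ) = (B:ℝ) ^ n * r := by
      push_cast; linear_combination hdiff
    rw [this]; exact ⟨hn3, hn1⟩

/-- Irrational multiples of words of a fixed length are dense modulo one. -/
theorem exists_words_dense_mod_one {B : ℕ} (hB : 2 ≤ B) {D : Finset ℕ} {d d' : ℕ} (hd : d ∈ D)
    (hd' : d' ∈ D) (hne : d ≠ d') {μ : ℝ} (hμ : Irrational μ) {η : ℝ} (hη : 0 < η) :
    ∃ J : ℕ, ∀ c : ℝ, ∃ a ∈ digitWords B D J, ∃ z : ℤ, |μ * a + c - z| ≤ η := by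
  have hB0 : (0:ℝ) < B := by exact_mod_cast (by omega : 0 < B)
  have chain : ∀ n : ℕ, ∃ J : ℕ, ∃ b T : ℝ, n * (η / B) ≤ T ∧
      (∃ w ∈ digitWords B D J, ∃ z : ℤ, μ * w = b + T + z) ∧
      ∀ θ, 0 ≤ θ → θ ≤ T → ∃ a ∈ digitWords B D J, ∃ z : ℤ, |μ * a - b - θ - z| ≤ η := by
    intro n
    induction n with
    | zero =>
      refine ⟨0, 0, 0, by simp, ⟨0, by simp [digitWords], 0, by simp⟩, fun θ h0 h1 => ?_⟩
      exact ⟨0, by simp [digitWords], 0, by rw [le_antisymm h1 h0]; simpa using hη.le⟩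
    | succ n ih =>
      obtain ⟨J, b, T, hT, ⟨w, hw, z₀, hwz⟩, hcov⟩ := ih
      obtain ⟨l, x, hx, y, hy, z₁, h1, h2⟩ := exists_words_small_shift hB hd hd' hne
        (show Irrational (μ * (B ^ J : ℕ)) from hμ.mul_natCast (by positivity)) hη
      set ρ : ℝ := μ * (B ^ J : ℕ) * ((y:ℝ) - x) - z₁ with hρ
      refine ⟨l + J, b + μ * (x * B ^ J), T + ρ, ?_, ⟨y * B ^ J + w, digitWords_append hy hw,
        z₀ + z₁, ?_⟩, fun θ h0 hθ => ?_⟩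
      · push_cast; linarith
      · rw [hρ]; push_cast; linear_combination hwz
      · rcases le_or_gt θ T with hle | hgt
        · obtain ⟨a, ha, z, hz⟩ := hcov θ h0 hle
          refine ⟨x * B ^ J + a, digitWords_append hx ha, z, le_of_eq_of_le ?_ hz⟩
          congr 1; push_cast; ring
        · refine ⟨y * B ^ J + w, digitWords_append hy hw, z₀ + z₁, ?_⟩
          have : μ * ((y * B ^ J + w : ℕ) : ℝ) - (b + μ * (x * B ^ J)) - θ - ((z₀ + z₁ : ℤ) : ℝ) =
              T + ρ - θ := by
            rw [hρ]; push_cast; linear_combination hwz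
          rw [this, abs_of_nonneg (by linarith)]; linarith
  obtain ⟨n, hn⟩ := exists_nat_ge (1 / (η / B))
  rw [div_le_iff₀ (by positivity)] at hn
  obtain ⟨J, b, T, hT, -, hcov⟩ := chain n
  refine ⟨J, fun c => ?_⟩
  obtain ⟨a, ha, z, hz⟩ := hcov (Int.fract (-c - b)) (Int.fract_nonneg _)
    ((Int.fract_lt_one _).le.trans (hn.trans hT))
  refine ⟨a, ha, z - ⌊-c - b⌋, le_of_eq_of_le ?_ hz⟩
  congr 1; rw [Int.fract]; push_cast; ring

theorem countable_setOf_not_irrational (ρ u₀ : ℝ) (hρ : ρ ≠ 0) :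
    {u : ℝ | u = u₀ ∨ ¬ Irrational (ρ / (u - u₀) ^ 2)}.Countable := by
  refine Set.Countable.mono (s₂ := {u₀} ∪ (range (fun a : ℚ => u₀ + √(ρ / a)) ∪
    range fun a : ℚ => u₀ - √(ρ / a))) ?_
    ((countable_singleton _).union ((countable_range _).union (countable_range _)))
  rintro u (rfl | hu)
  · exact Or.inl rfl
  by_cases h : u = u₀
  · exact Or.inl h
  right
  obtain ⟨a, ha⟩ : ρ / (u - u₀) ^ 2 ∈ range ((↑) : ℚ → ℝ) := not_not.1 hu
  have hsq : (u - u₀) ^ 2 ≠ 0 := pow_ne_zero _ (sub_ne_zero.2 h)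
  have ha0 : (a:ℝ) ≠ 0 := by rw [ha]; exact div_ne_zero hρ hsq
  have hs : √(ρ / a) = |u - u₀| := by
    rw [← Real.sqrt_sq_eq_abs]; congr 1
    rw [div_eq_iff ha0, ha]; field_simp
  rcases abs_choice (u - u₀) with h1 | h1
  · exact Or.inl ⟨a, by simp only; rw [hs, h1]; ring⟩
  · exact Or.inr ⟨a, by simp only; rw [hs, h1]; ring⟩

theorem exists_digitValue_notMem {B : ℕ} (hB : 2 ≤ B) {D : Finset ℕ} (hDB : ∀ d ∈ D, d < B)
    (hD2 : 2 ≤ D.card) {S : Set ℝ} (hS : S.Countable) :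
    ∃ ω : ℕ → ℕ, (∀ i, ω i ∈ D) ∧ digitValue B ω ∉ S := by
  by_contra! hcon
  have hD : D.Nonempty := Finset.card_pos.1 (by omega)
  have hBR : (2:ℝ) ≤ B := by exact_mod_cast hB
  have hlog : 0 < Real.log 2 / Real.log B :=
    div_pos (Real.log_pos (by norm_num)) (Real.log_pos (by linarith))
  have h := le_dimH_of_digitMeasure hB hD hDB hD2 (r := NNReal.mk _ hlog.le) (by
    rw [NNReal.coe_mk, Real.rpow_def_of_pos (by linarith),
      mul_div_cancel₀ _ (Real.log_pos (by linarith)).ne', Real.exp_log (by norm_num)]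
    exact_mod_cast hD2) (T := S) (by
      filter_upwards [ae_mem_digits hD] with ω hω using hcon ω hω)
  rw [hS.dimH_zero] at h
  rw [nonpos_iff_eq_zero, ENNReal.coe_eq_zero] at h
  exact hlog.ne' (congrArg NNReal.toReal h)

/-- From the renormalised position `u₀` with parameter `ρ`, words of length `2 * N` steer the
inversion `u ↦ ρ * B ^ N / (u - u₀)` into any prescribed arc of length `2 * r` modulo one. -/
def Steerable (B : ℕ) (D : Finset ℕ) (r : ℝ) (N : ℕ) (x : ℝ × ℝ) : Prop :=
  ∃ ε : ℤ, (ε = 1 ∨ ε = -1) ∧ ∀ c : ℝ, ∃ σ ∈ digitWords B D (2 * N), ∀ v : ℝ, 0 ≤ v → v ≤ 1 →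
    0 < ε * ((σ + v) / (B:ℝ) ^ (2 * N) - x.2) ∧
    ∃ z : ℤ, |ε * (x.1 * (B:ℝ) ^ N / ((σ + v) / (B:ℝ) ^ (2 * N) - x.2)) + c - z| < r

theorem eventually_steerable_nhds {B : ℕ} (hB : 2 ≤ B) {D : Finset ℕ} (hDB : ∀ d ∈ D, d < B)
    (hD2 : 2 ≤ D.card) {r : ℝ} (hr : 0 < r) (x₀ : ℝ × ℝ) (hx₀ : x₀.1 ≠ 0) :
    ∃ U ∈ nhds x₀, ∀ᶠ N in atTop, ∀ x ∈ U, Steerable B D r N x := by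
  obtain ⟨ρ₀, u₀⟩ := x₀
  simp only at hx₀
  have hBR : (2:ℝ) ≤ B := by exact_mod_cast hB
  have hB0 : (0:ℝ) < B := by linarith
  obtain ⟨d, hd, d', hd', hne⟩ := Finset.one_lt_card.1 (by omega : 1 < D.card)
  obtain ⟨ω, hω, hωS⟩ := exists_digitValue_notMem hB hDB hD2
    (countable_setOf_not_irrational ρ₀ u₀ hx₀)
  have hωB : ∀ i, ω i < B := fun i => hDB _ (hω i)
  set us : ℝ := digitValue B ω with hus
  obtain ⟨hus0, hirr⟩ := not_or.1 hωS
  rw [not_not] at hirr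
  set lam : ℝ := ρ₀ / (us - u₀) ^ 2 with hlam
  have hδ : us - u₀ ≠ 0 := sub_ne_zero.2 hus0
  obtain ⟨ε, hε, hεp⟩ : ∃ ε : ℤ, (ε = 1 ∨ ε = -1) ∧ 0 < (ε:ℝ) * (us - u₀) := by
    rcases lt_or_gt_of_ne hδ with h | h
    · exact ⟨-1, Or.inr rfl, by push_cast; linarith⟩
    · exact ⟨1, Or.inl rfl, by push_cast; linarith⟩
  have hε2 : |(ε:ℝ)| = 1 := by rcases hε with rfl | rfl <;> simp
  have hirr' : Irrational (-(ε:ℝ) * lam) := by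
    rcases hε with rfl | rfl
    · simpa using hirr.neg
    · simpa using hirr
  obtain ⟨J, hJ⟩ := exists_words_dense_mod_one hB hd hd' hne hirr' (show 0 < r / 4 by linarith)
  have hcont : ∀ᶠ p : (ℝ × ℝ) × (ℝ × ℝ) in nhds ((ρ₀, u₀), (us, us)),
      (|p.1.1 / ((p.2.1 - p.1.2) * (p.2.2 - p.1.2)) - lam| < r / (4 * (B:ℝ) ^ J) ∧
        0 < (ε:ℝ) * (p.2.1 - p.1.2)) ∧ 0 < (ε:ℝ) * (p.2.2 - p.1.2) := by
    refine Filter.Eventually.and (Filter.Eventually.and ?_ ?_) ?_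
    · have hc : ContinuousAt (fun p : (ℝ × ℝ) × (ℝ × ℝ) =>
          |p.1.1 / ((p.2.1 - p.1.2) * (p.2.2 - p.1.2)) - lam|) ((ρ₀, u₀), (us, us)) := by
        refine ContinuousAt.abs (ContinuousAt.sub (ContinuousAt.div ?_ ?_ ?_) continuousAt_const)
        · fun_prop
        · fun_prop
        · exact mul_ne_zero hδ hδ
      refine hc.eventually_lt continuousAt_const ?_
      simp only [hlam]
      rw [← pow_two, sub_self, abs_zero]; positivity
    · have hc : Continuous fun p : (ℝ × ℝ) × (ℝ × ℝ) => (ε:ℝ) * (p.2.1 - p.1.2) := by fun_prop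
      exact hc.continuousAt.eventually_const_lt hεp
    · have hc : Continuous fun p : (ℝ × ℝ) × (ℝ × ℝ) => (ε:ℝ) * (p.2.2 - p.1.2) := by fun_prop
      exact hc.continuousAt.eventually_const_lt hεp
  rw [nhds_prod_eq, Filter.eventually_prod_iff] at hcont
  obtain ⟨pa, hpa, pb, hpb, hab⟩ := hcont
  obtain ⟨η, hη, hpbη⟩ := Metric.eventually_nhds_iff.1 hpb
  refine ⟨{x | pa x}, hpa, ?_⟩
  have hBinv : Tendsto (fun N : ℕ => ((B:ℝ) ^ N)⁻¹) atTop (nhds 0) :=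
    (tendsto_pow_atTop_atTop_of_one_lt (by linarith)).inv_tendsto_atTop
  have hev1 : ∀ᶠ N : ℕ in atTop, 2 * (B:ℝ) ^ J * ((B:ℝ) ^ N)⁻¹ < η := by
    have := hBinv.const_mul (2 * (B:ℝ) ^ J)
    rw [mul_zero] at this; exact this.eventually_lt_const hη
  have hev2 : ∀ᶠ N : ℕ in atTop, |lam| * ((B:ℝ) ^ N)⁻¹ < r / 4 := by
    have := hBinv.const_mul |lam|
    rw [mul_zero] at this; exact this.eventually_lt_const (by linarith)
  filter_upwards [hev1, hev2, eventually_ge_atTop J] with N hN1 hN2 hNJ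
  rintro ⟨ρ, u1⟩ hx
  obtain ⟨m, rfl⟩ := Nat.exists_eq_add_of_le hNJ
  have hBJ : (0:ℝ) < (B:ℝ) ^ J := by positivity
  have hBm : (0:ℝ) < (B:ℝ) ^ m := by positivity
  have hBN : (0:ℝ) < (B:ℝ) ^ (J + m) := by positivity
  have hN1' : 2 / (B:ℝ) ^ m < η := by
    refine lt_of_eq_of_lt ?_ hN1
    rw [pow_add]; field_simp
  set pm : ℕ := digitPrefix B ω m with hpm
  set um : ℝ := pm / (B:ℝ) ^ m with hum
  have hus_mem := digitValue_mem_Icc hB hωB m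
  rw [← hus, ← hpm, add_div, ← hum] at hus_mem
  set en : ℕ := digitPrefix B (fun _ => d) (J + m) with hen
  set κs : ℝ := digitValue B (fun _ => d) with hκs
  have hκ_mem := digitValue_mem_Icc hB (ω := fun _ => d) (fun _ => hDB d hd) (J + m)
  rw [← hκs, ← hen, add_div] at hκ_mem
  have hen_mem : en ∈ digitWords B D (J + m) := digitPrefix_mem (fun _ => hd) _
  refine ⟨ε, hε, fun c => ?_⟩
  obtain ⟨a, ha, z, hz⟩ := hJ (ε * (ρ * (B:ℝ) ^ (J + m)) / (um - u1) + c - ε * lam * κs)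
  have haB : (a:ℝ) + 1 ≤ (B:ℝ) ^ J := by exact_mod_cast digitWords_lt hDB ha
  have henB : (en:ℝ) + 1 ≤ (B:ℝ) ^ (J + m) := by exact_mod_cast digitWords_lt hDB hen_mem
  refine ⟨(pm * B ^ J + a) * B ^ (J + m) + en, ?_, fun v hv0 hv1 => ?_⟩
  · have := digitWords_append (digitWords_append (digitPrefix_mem hω m) ha) hen_mem
    rwa [show m + J + (J + m) = 2 * (J + m) by ring] at this
  set κ : ℝ := (en + v) / (B:ℝ) ^ (J + m) with hκ
  have hκ0 : 0 ≤ κ := by positivity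
  have hκ1 : κ ≤ 1 := by rw [hκ, div_le_one hBN]; linarith
  set u : ℝ := ((((pm * B ^ J + a) * B ^ (J + m) + en : ℕ) : ℝ) + v) / (B:ℝ) ^ (2 * (J + m)) with hu
  have hu_eq : u - um = (a + κ) / (B:ℝ) ^ (J + m) := by
    rw [hu, hum, hκ, two_mul, pow_add (B:ℝ) (J + m) (J + m)]
    push_cast
    field_simp
    rw [pow_add]; ring
  have hum_dist : |um - us| ≤ 1 / (B:ℝ) ^ m := by
    rw [abs_le]; constructor <;> linarith [hus_mem.1, hus_mem.2, one_div_pos.2 hBm]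
  have huum : |u - um| ≤ 1 / (B:ℝ) ^ m := by
    rw [hu_eq, abs_of_nonneg (by positivity), div_le_div_iff₀ hBN hBm, pow_add]
    nlinarith
  have hu_dist : |u - us| ≤ 2 / (B:ℝ) ^ m := by
    have h := abs_sub_le u um us
    have e : 2 / (B:ℝ) ^ m = 1 / (B:ℝ) ^ m + 1 / (B:ℝ) ^ m := by ring
    linarith
  have hpbx : pb (u, um) := by
    refine hpbη ?_
    rw [Prod.dist_eq, max_lt_iff, Real.dist_eq, Real.dist_eq]
    refine ⟨hu_dist.trans_lt hN1', hum_dist.trans_lt (lt_of_le_of_lt ?_ hN1')⟩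
    gcongr; norm_num
  obtain ⟨⟨hbr, hp1⟩, hp2⟩ := hab hx hpbx
  simp only at hbr hp1 hp2
  refine ⟨hp1, z, ?_⟩
  set br : ℝ := ρ / ((u - u1) * (um - u1)) with hbrdef
  have hne1 : u - u1 ≠ 0 := by rintro h; rw [h, mul_zero] at hp1; exact lt_irrefl _ hp1
  have hne2 : um - u1 ≠ 0 := by rintro h; rw [h, mul_zero] at hp2; exact lt_irrefl _ hp2
  have hkey : ρ * (B:ℝ) ^ (J + m) / (u - u1) = ρ * (B:ℝ) ^ (J + m) / (um - u1) - br * (a + κ) := by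
    have h3 : (a:ℝ) + κ = (u - um) * (B:ℝ) ^ (J + m) := by rw [hu_eq]; field_simp
    rw [h3, hbrdef]; field_simp; ring
  have hκd : |κs - κ| ≤ ((B:ℝ) ^ (J + m))⁻¹ := by
    have h1 : κ = en / (B:ℝ) ^ (J + m) + v * ((B:ℝ) ^ (J + m))⁻¹ := by rw [hκ]; ring
    have h2 : v * ((B:ℝ) ^ (J + m))⁻¹ ≤ ((B:ℝ) ^ (J + m))⁻¹ :=
      mul_le_of_le_one_left (by positivity) hv1
    have h3 : 0 ≤ v * ((B:ℝ) ^ (J + m))⁻¹ := by positivity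
    rw [one_div] at hκ_mem
    rw [abs_le]; constructor <;> linarith [hκ_mem.1, hκ_mem.2]
  have herr : |(ε:ℝ) * (lam * (κs - κ) + (lam - br) * (a + κ))| < r / 2 := by
    rw [abs_mul, hε2, one_mul]
    refine (abs_add_le _ _).trans_lt ?_
    rw [abs_mul, abs_mul]
    have h1 : |lam| * |κs - κ| < r / 4 :=
      (mul_le_mul_of_nonneg_left hκd (abs_nonneg _)).trans_lt hN2
    have h2 : |lam - br| * |(a:ℝ) + κ| ≤ r / 4 := by
      rw [abs_sub_comm, abs_of_nonneg (by positivity : 0 ≤ (a:ℝ) + κ)]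
      calc |br - lam| * (a + κ) ≤ r / (4 * (B:ℝ) ^ J) * (B:ℝ) ^ J :=
            mul_le_mul hbr.le (by linarith) (by positivity) (by positivity)
        _ = r / 4 := by field_simp
    linarith
  have hfin : (ε:ℝ) * (ρ * (B:ℝ) ^ (J + m) / (u - u1)) + c - z =
      (-(ε:ℝ) * lam * a + (ε * (ρ * (B:ℝ) ^ (J + m)) / (um - u1) + c - ε * lam * κs) - z) +
      ε * (lam * (κs - κ) + (lam - br) * (a + κ)) := by
    rw [hkey]; ring
  rw [hfin]
  refine (abs_add_le _ _).trans_lt ?_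
  linarith

theorem exists_steerable {B : ℕ} (hB : 2 ≤ B) {D : Finset ℕ} (hDB : ∀ d ∈ D, d < B)
    (hD2 : 2 ≤ D.card) {r : ℝ} (hr : 0 < r) :
    ∃ N, 1 ≤ N ∧ ∀ x ∈ Icc (1:ℝ) 16 ×ˢ Icc (-1:ℝ) 1, Steerable B D r N x := by
  have h : ∀ᶠ N in atTop, ∀ x ∈ Icc (1:ℝ) 16 ×ˢ Icc (-1:ℝ) 1, Steerable B D r N x := by
    refine (isCompact_Icc.prod isCompact_Icc).induction_on
      (p := fun A => ∀ᶠ N in atTop, ∀ x ∈ A, Steerable B D r N x) (by simp)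
      (fun A A' hA h => h.mono fun N hN x hx => hN x (hA hx))
      (fun A A' h h' => ?_) fun x hx => ?_
    · filter_upwards [h, h'] with N hN hN' x hx
      exact hx.elim (hN x) (hN' x)
    · obtain ⟨U, hU, h⟩ := eventually_steerable_nhds hB hDB hD2 hr x (by
        have := hx.1.1; linarith)
      exact ⟨U, mem_nhdsWithin_of_mem_nhds hU, h⟩
  obtain ⟨N, hN, h1⟩ := (h.and (eventually_ge_atTop 1)).exists
  exact ⟨N, h1, hN⟩

theorem mem_digitWords_add {B : ℕ} {D : Finset ℕ} {m k w : ℕ} (hw : w ∈ digitWords B D (m + k)) :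
    ∃ a ∈ digitWords B D m, ∃ b ∈ digitWords B D k, w = a * B ^ k + b := by
  induction k generalizing w with
  | zero => exact ⟨w, hw, 0, by simp [digitWords], by simp⟩
  | succ k ih =>
    obtain ⟨w', hw', d, hd, rfl⟩ := mem_digitWords_succ.1 hw
    obtain ⟨a, ha, b, hb, rfl⟩ := ih hw'
    exact ⟨a, ha, B * b + d, mem_digitWords_succ.2 ⟨b, hb, d, hd, rfl⟩, by ring⟩

/-- Every point whose expansion starts with the word `a` of length `m` lies in `G`. -/
def CylinderIn (B : ℕ) (G : Set ℝ) (m a : ℕ) : Prop :=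
  Icc ((a:ℝ) / (B:ℝ) ^ m) (((a:ℝ) + 1) / (B:ℝ) ^ m) ⊆ G

theorem CylinderIn.append {B : ℕ} (hB : 0 < B) {G : Set ℝ} {m a k b : ℕ} (h : CylinderIn B G m a)
    (hb : b < B ^ k) : CylinderIn B G (m + k) (a * B ^ k + b) := by
  have hB0 : (0:ℝ) < B := by exact_mod_cast hB
  have hbR : (b:ℝ) + 1 ≤ (B:ℝ) ^ k := by exact_mod_cast hb
  refine (Icc_subset_Icc ?_ ?_).trans h
  · rw [pow_add, div_le_div_iff₀ (by positivity) (by positivity)]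
    push_cast
    have : 0 ≤ (b:ℝ) * (B:ℝ) ^ m := by positivity
    linarith
  · rw [pow_add, div_le_div_iff₀ (by positivity) (by positivity)]
    push_cast
    nlinarith [pow_pos hB0 m]

/-- The words of length `m` whose cylinder is not contained in `G`. -/
def missingWords (B : ℕ) (D : Finset ℕ) (G : Set ℝ) (m : ℕ) : Finset ℕ :=
  open scoped Classical in (digitWords B D m).filter fun a => ¬ CylinderIn B G m a

theorem mem_missingWords {B : ℕ} {D : Finset ℕ} {G : Set ℝ} {m a : ℕ} :
    a ∈ missingWords B D G m ↔ a ∈ digitWords B D m ∧ ¬ CylinderIn B G m a := by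
  classical exact Finset.mem_filter

/-- If every word has a definite proportion of extensions with cylinder in `G`, then almost every
sequence of digits has its value in `G`. -/
theorem ae_digitValue_mem {B : ℕ} (hB : 2 ≤ B) {D : Finset ℕ} (hD : D.Nonempty)
    (hDB : ∀ d ∈ D, d < B) (G : Set ℝ) {c : ℝ} (hc : 0 < c) {C : ℕ}
    (hext : ∀ τ v : ℕ, ∀ᶠ t in atTop, ∃ E ⊆ digitWords B D (2 * t + C - τ),
      c * (D.card : ℝ) ^ (2 * t + C - τ) ≤ E.card ∧
        ∀ b ∈ E, CylinderIn B G (2 * t + C) (v * B ^ (2 * t + C - τ) + b)) :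
    ∀ᵐ ω ∂digitMeasure D, digitValue B ω ∈ G := by
  have hDc : (0:ℝ) < D.card := by exact_mod_cast hD.card_pos
  have hstep : ∀ τ, ∃ m, ((missingWords B D G m).card : ℝ) / (D.card : ℝ) ^ m ≤
      (1 - c) * ((missingWords B D G τ).card / (D.card : ℝ) ^ τ) := by
    intro τ
    have hall : ∀ᶠ t in atTop, ∀ v ∈ digitWords B D τ, ∃ E ⊆ digitWords B D (2 * t + C - τ),
      c * (D.card : ℝ) ^ (2 * t + C - τ) ≤ E.card ∧
        ∀ b ∈ E, CylinderIn B G (2 * t + C) (v * B ^ (2 * t + C - τ) + b) :=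
      (Filter.eventually_all_finset _).2 fun v _ => hext τ v
    obtain ⟨t, ht, htτ⟩ := (hall.and (eventually_ge_atTop τ)).exists
    obtain ⟨k, hk⟩ : ∃ k, 2 * t + C = τ + k := ⟨2 * t + C - τ, by omega⟩
    rw [hk, Nat.add_sub_cancel_left] at ht
    refine ⟨τ + k, ?_⟩
    choose! E hE hEc hEG using ht
    have hsub : missingWords B D G (τ + k) ⊆ (missingWords B D G τ).biUnion fun v =>
        (digitWords B D k \ E v).image fun b => v * B ^ k + b := by
      intro w hw
      obtain ⟨hw1, hw2⟩ := mem_missingWords.1 hw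
      obtain ⟨v, hv, b, hb, rfl⟩ := mem_digitWords_add hw1
      rw [Finset.mem_biUnion]
      refine ⟨v, mem_missingWords.2 ⟨hv, fun h => hw2 (h.append (by omega) (digitWords_lt hDB hb))⟩,
        Finset.mem_image.2 ⟨b, Finset.mem_sdiff.2 ⟨hb, fun h => hw2 (hEG v hv b h)⟩, rfl⟩⟩
    have hcard : ((missingWords B D G (τ + k)).card : ℝ) ≤
        (missingWords B D G τ).card * ((1 - c) * (D.card : ℝ) ^ k) := by
      have h1 := (Finset.card_le_card hsub).trans Finset.card_biUnion_le
      refine (Nat.cast_le (α := ℝ).2 h1).trans ?_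
      rw [Nat.cast_sum, ← nsmul_eq_mul]
      refine Finset.sum_le_card_nsmul _ _ _ fun v hv => ?_
      have hv' := (mem_missingWords.1 hv).1
      have h2 := Nat.cast_le (α := ℝ).2
        (Finset.card_image_le (s := digitWords B D k \ E v) (f := fun b => v * B ^ k + b))
      refine h2.trans ?_
      rw [Finset.cast_card_sdiff (hE v hv'), card_digitWords hDB]
      have := hEc v hv'
      push_cast; linarith
    calc _ ≤ (missingWords B D G τ).card * ((1 - c) * (D.card : ℝ) ^ k) /
          (D.card : ℝ) ^ (τ + k) := by gcongr
      _ = _ := by rw [pow_add]; field_simp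
  have hc1 : 0 ≤ 1 - c := by
    obtain ⟨t, E, hE, hEc, -⟩ := (hext 0 0).exists
    have h1 := hEc.trans (Nat.cast_le.2 (Finset.card_le_card hE))
    rw [card_digitWords hDB, Nat.cast_pow] at h1
    nlinarith [pow_pos hDc (2 * t + C - 0)]
  have hiter : ∀ n : ℕ, ∃ m,
      ((missingWords B D G m).card : ℝ) / (D.card : ℝ) ^ m ≤ (1 - c) ^ n := by
    intro n
    induction n with
    | zero =>
      refine ⟨0, ?_⟩
      have := Finset.card_le_card (show missingWords B D G 0 ⊆ digitWords B D 0 from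
        fun a h => (mem_missingWords.1 h).1)
      rw [card_digitWords hDB] at this
      simpa using this
    | succ n ih =>
      obtain ⟨τ, hτ⟩ := ih
      obtain ⟨m, hm⟩ := hstep τ
      refine ⟨m, hm.trans ?_⟩
      rw [pow_succ']
      exact mul_le_mul_of_nonneg_left hτ hc1
  have hprob := digitMeasure_isProbabilityMeasure hD
  have hnull : ∀ n : ℕ, digitMeasure D {ω | ¬ digitValue B ω ∈ G} ≤
      ENNReal.ofReal ((1 - c) ^ n) := by
    intro n
    obtain ⟨m, hm⟩ := hiter n
    calc digitMeasure D {ω | ¬ digitValue B ω ∈ G}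
        ≤ digitMeasure D {ω | digitPrefix B ω m ∈ missingWords B D G m} := by
          refine measure_mono_ae ?_
          filter_upwards [ae_mem_digits hD] with ω hω hG
          refine mem_missingWords.2 ⟨digitPrefix_mem hω m, fun h => hG (h ?_)⟩
          exact digitValue_mem_Icc hB (fun i => hDB _ (hω i)) m
      _ ≤ (missingWords B D G m).card * ((D.card:ℝ≥0∞)⁻¹) ^ m :=
          digitMeasure_prefix_mem_le hD hDB m _
      _ = ENNReal.ofReal ((missingWords B D G m).card / (D.card : ℝ) ^ m) := by
          rw [ENNReal.ofReal_div_of_pos (by positivity), ENNReal.ofReal_pow hDc.le,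
            ENNReal.ofReal_natCast, ENNReal.ofReal_natCast, div_eq_mul_inv, ENNReal.inv_pow]
      _ ≤ _ := ENNReal.ofReal_le_ofReal hm
  rw [ae_iff]
  refine le_antisymm ?_ (zero_le)
  have hlim : Tendsto (fun n : ℕ => ENNReal.ofReal ((1 - c) ^ n)) atTop (nhds (ENNReal.ofReal 0)) :=
    ENNReal.tendsto_ofReal (tendsto_pow_atTop_nhds_zero_of_lt_one hc1 (by linarith))
  rw [ENNReal.ofReal_zero] at hlim
  exact ge_of_tendsto' hlim hnull

/-- Points close enough to a rational, at a position prescribed by a steering word, are sent into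
a prescribed interval by an iterate of the Gauss map. -/
theorem gaussMap_iterate_mem_of_steer {B : ℝ} (hB : 10 ≤ B) {N t' : ℕ} (hN : 1 ≤ N) {p : ℤ} {q : ℕ}
    (hq : 0 < q) {ε z : ℤ} {α β c w u ρ : ℝ} (hα : 0 ≤ α) (hβ : β ≤ 1)
    (hc1 : c ≤ 1)
    (hP : ∀ x y : ℝ, 2 < y → (x - p / (q:ℤ)) * ((q:ℤ) ^ 2 * (y + c)) = ε →
      ∃ k : ℕ, gaussMap^[k] (Int.fract x) = Int.fract y)
    (hε : ε = 1 ∨ ε = -1)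
    (hρ : ρ * (q:ℝ) ^ 2 = (B ^ t') ^ 2) (hρ1 : 1 ≤ ρ)
    (hu0 : |w - B ^ (2 * t' + N) * (p / q)| ≤ 1) (hu : 0 ≤ u) (hu1 : u ≤ 1)
    (hpos : 0 < ε * (u - (B ^ (2 * t' + N) * (p / q) - w)))
    (hz : |ε * (ρ * B ^ N / (u - (B ^ (2 * t' + N) * (p / q) - w))) + (-c - (α + β) / 2) - z|
      < (β - α) / 2) :
    ∃ k : ℕ, gaussMap^[k] (Int.fract ((w + u) / B ^ (2 * t' + N))) ∈ Ioo α β := by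
  have hB0 : (0:ℝ) < B := by linarith
  have hq0 : (0:ℝ) < q := by exact_mod_cast hq
  have hεR : (ε:ℝ) ^ 2 = 1 := by rcases hε with rfl | rfl <;> norm_num
  set Q : ℝ := B ^ (2 * t' + N) with hQ
  have hQ0 : 0 < Q := by positivity
  have hQe : Q = (B ^ t') ^ 2 * B ^ N := by rw [hQ]; ring
  have hBN : 10 ≤ B ^ N := hB.trans (le_self_pow₀ (by linarith) (by omega))
  set δ : ℝ := u - (Q * (p / q) - w) with hδ
  obtain ⟨h0a, h0b⟩ := abs_le.1 hu0
  have hδ0 : δ ≠ 0 := by rintro h; simp [h] at hpos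
  have hδ2 : ε * δ ≤ 2 := by
    rcases hε with rfl | rfl <;> push_cast <;> linarith
  set y : ℝ := ε * (ρ * B ^ N / δ) - c with hy
  have hyc : y + c = ρ * B ^ N / (ε * δ) := by
    have hε0 : (ε:ℝ) ≠ 0 := by rintro h; simp [h] at hεR
    rw [hy, sub_add_cancel]
    field_simp
    linear_combination hεR
  have hy2 : 2 < y := by
    have : 5 ≤ y + c := by
      rw [hyc, le_div_iff₀ hpos]
      nlinarith
    linarith
  have hx : ((w + u) / Q - p / (q:ℤ)) * ((q:ℤ) ^ 2 * (y + c)) = ε := by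
    have h1 : (w + u) / Q - p / (q:ℤ) = δ / Q := by
      rw [hδ]; field_simp; push_cast; ring
    have hε0 : (ε:ℝ) ≠ 0 := by rintro h; simp [h] at hεR
    rw [h1, hyc]
    push_cast
    have h2 : δ / Q * ((q:ℝ) ^ 2 * (ρ * B ^ N / (ε * δ))) = (ρ * q ^ 2 * B ^ N) / Q / ε := by
      field_simp
    rw [h2, hρ, ← hQe, div_self hQ0.ne']
    field_simp
    linarith
  obtain ⟨k, hk⟩ := hP _ y hy2 hx
  refine ⟨k, ?_⟩
  rw [hk]
  have hz' : |y - (α + β) / 2 - z| < (β - α) / 2 := by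
    convert hz using 2; rw [hy]; ring
  obtain ⟨hz1, hz2⟩ := abs_lt.1 hz'
  have hf : Int.fract y = y - z := by
    rw [Int.fract_eq_iff]
    exact ⟨by linarith, by linarith, z, by ring⟩
  rw [hf]
  exact ⟨by linarith, by linarith⟩

theorem eventually_exists_extensions {B : ℕ} (hB : 10 ≤ B) {D : Finset ℕ} (hDB : ∀ d ∈ D, d < B)
    (hD2 : 2 ≤ D.card) {γ : ℝ} (hγ : γ ^ 12 ≤ B)
    (hC : ∀ θ : ℝ, ∑ r ∈ Finset.range B, ‖∑ d ∈ D, expChar (d * (θ + r / B))‖ ≤ D.card * γ)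
    {α β : ℝ} (hα : 0 ≤ α) (hαβ : α < β) (hβ : β ≤ 1) :
    ∃ c : ℝ, 0 < c ∧ ∃ C : ℕ, ∀ τ v : ℕ, ∀ᶠ t in atTop, ∃ E ⊆ digitWords B D (2 * t + C - τ),
      c * (D.card : ℝ) ^ (2 * t + C - τ) ≤ E.card ∧
        ∀ b ∈ E, CylinderIn B {x | ∃ k : ℕ, gaussMap^[k] (Int.fract x) ∈ Ioo α β} (2 * t + C)
          (v * B ^ (2 * t + C - τ) + b) := by
  have hne : D.Nonempty := Finset.card_pos.1 (by omega)
  have hDc : (0:ℝ) < D.card := by exact_mod_cast hne.card_pos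
  have hBR : (10:ℝ) ≤ B := by exact_mod_cast hB
  have hB0 : (0:ℝ) < B := by linarith
  obtain ⟨N, hN, hsteer⟩ := exists_steerable (B := B) (D := D) (r := (β - α) / 2)
    (by omega) hDB hD2 (by linarith)
  obtain ⟨c, hc, hnear⟩ := exists_card_nearWords_ge hB hDB hne hγ hC N
  refine ⟨c / (D.card : ℝ) ^ (2 * N), by positivity, 3 * N, fun τ v => ?_⟩
  filter_upwards [hnear τ v, eventually_ge_atTop τ] with t' hcard ht'
  obtain ⟨k, hk⟩ : ∃ k, 2 * t' + N = τ + k := ⟨2 * t' + N - τ, by omega⟩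
  have hk1 : 2 * t' + N - τ = k := by omega
  have hk2 : 2 * t' + 3 * N - τ = k + 2 * N := by omega
  have hk3 : 2 * t' + 3 * N = 2 * t' + N + 2 * N := by omega
  rw [hk1] at hcard
  rw [hk2, hk3]
  have hσ : ∀ b ∈ nearWords B D v k (2 * t' + N) t', ∃ σ ∈ digitWords B D (2 * N),
      CylinderIn B {x | ∃ k : ℕ, gaussMap^[k] (Int.fract x) ∈ Ioo α β} (2 * t' + N + 2 * N)
        ((v * B ^ k + b) * B ^ (2 * N) + σ) := by
    intro b hb
    obtain ⟨hbw, q, hq, p, hpq, hw⟩ := mem_nearWords.1 hb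
    obtain ⟨hqX, hXq⟩ := Finset.mem_filter.1 hq
    obtain ⟨hq0, hqX⟩ := Finset.mem_Ioc.1 hqX
    have hq0R : (0:ℝ) < q := by exact_mod_cast hq0
    have hqXR : (q:ℝ) ≤ (B:ℝ) ^ t' := by exact_mod_cast hqX
    have hXqR : (B:ℝ) ^ t' ≤ 4 * q := by exact_mod_cast hXq.le
    obtain ⟨ε, hε, hst⟩ := hsteer (((B:ℝ) ^ t') ^ 2 / (q:ℝ) ^ 2,
        (B:ℝ) ^ (2 * t' + N) * (p / q) - ((v * B ^ k + b : ℕ) : ℝ)) (by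
      refine ⟨⟨?_, ?_⟩, ?_⟩
      · rw [one_le_div (by positivity)]; gcongr
      · rw [div_le_iff₀ (by positivity)]; nlinarith [pow_pos hB0 t']
      · obtain ⟨h1, h2⟩ := abs_le.1 hw
        exact ⟨by linarith, by linarith⟩)
    obtain ⟨c', -, hc1, hP⟩ := gaussMap_iterate_near_rational p q (by exact_mod_cast hq0) hpq ε hε
    obtain ⟨σ, hσ, hv⟩ := hst (-c' - (α + β) / 2)
    refine ⟨σ, hσ, fun x hx => ?_⟩
    have hσB : (σ:ℝ) + 1 ≤ (B:ℝ) ^ (2 * N) := by exact_mod_cast digitWords_lt hDB hσ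
    set P : ℝ := (B:ℝ) ^ (2 * N) with hPdef
    have hP0 : 0 < P := by positivity
    set Q : ℝ := (B:ℝ) ^ (2 * t' + N) with hQdef
    have hQ0 : 0 < Q := by positivity
    set w : ℕ := v * B ^ k + b with hwdef
    obtain ⟨hx1, hx2⟩ := hx
    rw [pow_add, ← hPdef, ← hQdef, div_le_iff₀ (by positivity)] at hx1
    rw [pow_add, ← hPdef, ← hQdef, le_div_iff₀ (by positivity)] at hx2
    push_cast [← hPdef] at hx1 hx2
    set v0 : ℝ := x * (Q * P) - (w * P + σ) with hv0
    obtain ⟨hd, z, hz⟩ := hv v0 (by linarith) (by linarith)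
    have hxe : x = (w + (σ + v0) / P) / Q := by
      rw [hv0]; field_simp; ring
    rw [hxe]
    refine gaussMap_iterate_mem_of_steer hBR hN hq0 hα hβ hc1 hP hε
      (ρ := ((B:ℝ) ^ t') ^ 2 / (q:ℝ) ^ 2) (by field_simp) ?_ hw ?_ ?_ hd hz
    · rw [one_le_div (by positivity)]; gcongr
    · have : (0:ℝ) ≤ σ := by positivity
      have : 0 ≤ σ + v0 := by linarith
      positivity
    · rw [div_le_one hP0]; linarith
  choose! σ hσw hσG using hσ
  refine ⟨(nearWords B D v k (2 * t' + N) t').image fun b => b * B ^ (2 * N) + σ b, ?_, ?_, ?_⟩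
  · intro a ha
    obtain ⟨b, hb, rfl⟩ := Finset.mem_image.1 ha
    exact digitWords_append (mem_nearWords.1 hb).1 (hσw b hb)
  · rw [Finset.card_image_of_injOn, pow_add]
    · refine le_trans (le_of_eq ?_) hcard
      rw [div_mul_eq_mul_div, mul_div_assoc, mul_div_cancel_right₀ _ (pow_ne_zero _ hDc.ne')]
    · intro b hb b' hb' h
      have h1 := digitWords_lt hDB (hσw b hb)
      have h2 := digitWords_lt hDB (hσw b' hb')
      have hpos : 0 < B ^ (2 * N) := by positivity
      have h3 := congrArg (· / B ^ (2 * N)) h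
      simpa [Nat.mul_add_div, Nat.div_eq_of_lt, h1, h2, hpos, mul_comm _ (B ^ (2 * N))] using h3
  · intro a ha
    obtain ⟨b, hb, rfl⟩ := Finset.mem_image.1 ha
    have := hσG b hb
    rwa [show v * B ^ (k + 2 * N) + (b * B ^ (2 * N) + σ b) =
      (v * B ^ k + b) * B ^ (2 * N) + σ b by ring]

theorem ae_dense_gaussMap_orbit {B : ℕ} (hB : 10 ≤ B) {D : Finset ℕ} (hDB : ∀ d ∈ D, d < B)
    (hD2 : 2 ≤ D.card) {γ : ℝ} (hγ : γ ^ 12 ≤ B)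
    (hC : ∀ θ : ℝ, ∑ r ∈ Finset.range B, ‖∑ d ∈ D, expChar (d * (θ + r / B))‖ ≤ D.card * γ) :
    ∀ᵐ ω ∂digitMeasure D, Ico (0:ℝ) 1 ⊆
      closure (range fun k : ℕ => gaussMap^[k] (Int.fract (digitValue B ω))) := by
  have hne : D.Nonempty := Finset.card_pos.1 (by omega)
  have hall : ∀ᵐ ω ∂digitMeasure D, ∀ α β : ℚ, 0 ≤ α → α < β → β ≤ 1 →
      ∃ k : ℕ, gaussMap^[k] (Int.fract (digitValue B ω)) ∈ Ioo (α:ℝ) β := by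
    simp only [ae_all_iff]
    intro α β hα hαβ hβ
    obtain ⟨c, hc, C, hext⟩ := eventually_exists_extensions hB hDB hD2 hγ hC (α := α) (β := β)
      (by exact_mod_cast hα) (by exact_mod_cast hαβ) (by exact_mod_cast hβ)
    exact ae_digitValue_mem (by omega) hne hDB _ hc hext
  filter_upwards [hall] with ω hω x hx
  rw [Metric.mem_closure_range_iff]
  intro ε hε
  obtain ⟨α, hα, hα'⟩ := exists_rat_btwn (show x < min 1 (x + ε) from lt_min hx.2 (by linarith))
  obtain ⟨β, hβ, hβ'⟩ := exists_rat_btwn hα'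
  have h1 := min_le_left 1 (x + ε)
  have h2 := min_le_right 1 (x + ε)
  obtain ⟨k, hk1, hk2⟩ := hω α β (by exact_mod_cast (hx.1.trans hα.le)) (by exact_mod_cast hβ)
    (by exact_mod_cast hβ'.le.trans h1)
  refine ⟨k, ?_⟩
  rw [dist_comm, Real.dist_eq, abs_lt]
  constructor <;> linarith

theorem exists_large_base {n : ℕ} (hn : 2 ≤ n) (a : ℕ) {r : ℝ} (hr : r < 1) :
    ∃ N : ℕ, 0 < N ∧ 10 ≤ n ^ N ∧
      (2 * (3 + Real.log ((n ^ N : ℕ) : ℝ) + (a * N : ℕ))) ^ 12 ≤ ((n ^ N : ℕ) : ℝ) ∧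
      2 * ((n ^ N : ℕ) : ℝ) ^ r ≤ ((n ^ N : ℕ) : ℝ) := by
  have hn1 : (1:ℝ) < n := by exact_mod_cast (by omega : 1 < n)
  have hlog : 0 ≤ Real.log n := Real.log_nonneg hn1.le
  set K : ℝ := 2 * (3 + Real.log n + a) with hK
  have hK0 : 0 < K := by positivity
  have hBtop : Tendsto (fun N : ℕ => (n:ℝ) ^ N) atTop atTop := tendsto_pow_atTop_atTop_of_one_lt hn1
  have h1 : ∀ᶠ N : ℕ in atTop, (N:ℝ) ^ 12 / (n:ℝ) ^ N < (K ^ 12)⁻¹ :=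
    (tendsto_pow_const_div_const_pow_of_one_lt 12 hn1).eventually (gt_mem_nhds (by positivity))
  have h2 : ∀ᶠ N : ℕ in atTop, 2 ≤ ((n:ℝ) ^ N) ^ (1 - r) :=
    ((tendsto_rpow_atTop (by linarith : 0 < 1 - r)).comp hBtop).eventually (eventually_ge_atTop 2)
  obtain ⟨N, ⟨⟨h1, h2⟩, h3⟩, h4⟩ :=
    (((h1.and h2).and (hBtop.eventually (eventually_ge_atTop 10))).and (eventually_gt_atTop 0)).exists
  have hB0 : (0:ℝ) < (n:ℝ) ^ N := by positivity
  have hN1 : (1:ℝ) ≤ N := by exact_mod_cast h4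
  refine ⟨N, h4, by exact_mod_cast h3, ?_, ?_⟩ <;> push_cast
  · have h5 : 2 * (3 + Real.log ((n:ℝ) ^ N) + a * N) ≤ K * N := by
      rw [Real.log_pow, hK]; linarith
    have h6 : 0 ≤ Real.log ((n:ℝ) ^ N) := by rw [Real.log_pow]; positivity
    calc _ ≤ (K * N) ^ 12 := by gcongr
      _ = K ^ 12 * (N:ℝ) ^ 12 := mul_pow _ _ _
      _ ≤ (n:ℝ) ^ N := by
        rw [div_lt_iff₀ hB0, inv_mul_eq_div, lt_div_iff₀ (by positivity)] at h1
        linarith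
  · calc 2 * ((n:ℝ) ^ N) ^ r ≤ ((n:ℝ) ^ N) ^ (1 - r) * ((n:ℝ) ^ N) ^ r := by gcongr
      _ = (n:ℝ) ^ N := by rw [← Real.rpow_add hB0, sub_add_cancel, Real.rpow_one]

theorem dense_gauss_nondense_times_n (n : ℤ) (hn : 2 ≤ n) (S : Set Circ) (hS : S.Finite)
    (t₀ : ℝ) (ht₀ : 0 < t₀) :
    dimH {s : ℝ |
      closure (Set.range fun k : ℕ => (fun x : Circ => n • x)^[k] (s : Circ)) ∩ S = ∅ ∧
      Set.Ico (0:ℝ) 1 ⊆ closure (Set.range fun k : ℕ => gaussMap^[k] (Int.fract s))} = 1 := by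
  refine le_antisymm ((dimH_mono (subset_univ _)).trans Real.dimH_univ.le) ?_
  refine ENNReal.le_of_forall_nnreal_lt fun r hr => ?_
  obtain ⟨n, rfl⟩ := Int.eq_ofNat_of_zero_le (by omega : 0 ≤ n)
  have hn2 : 2 ≤ n := by exact_mod_cast hn
  obtain ⟨N, hN, hB, hγ, hBr⟩ := exists_large_base hn2 (3 * S.ncard) (r := r) (by exact_mod_cast hr)
  obtain ⟨D, hDB, hcard, havoid⟩ := exists_digits_avoiding n hn2 S hS N hN
  generalize n ^ N = B at *
  generalize 3 * S.ncard * N = b at *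
  have hBR : (10:ℝ) ≤ B := by exact_mod_cast hB
  have hlog : 0 ≤ Real.log B := Real.log_nonneg (by linarith)
  set γ : ℝ := 2 * (3 + Real.log B + b) with hγdef
  have hγ1 : 1 ≤ γ := by
    have : (0:ℝ) ≤ b := by positivity
    linarith
  have hγB : γ ≤ B := (le_self_pow₀ hγ1 (by norm_num)).trans hγ
  have hcardR : (B:ℝ) ≤ D.card + b := by exact_mod_cast hcard
  have hhalf : (B:ℝ) ≤ 2 * D.card := by linarith
  have hD2 : 2 ≤ D.card := by
    have : (2:ℝ) ≤ D.card := by linarith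
    exact_mod_cast this
  have hne : D.Nonempty := Finset.card_pos.1 (by omega)
  have hC : ∀ θ : ℝ, ∑ r ∈ Finset.range B, ‖∑ d ∈ D, expChar (d * (θ + r / B))‖ ≤ D.card * γ := by
    intro θ
    refine (sum_norm_digit_expChar_le (by omega) hDB hcard θ).trans ?_
    have : 0 ≤ 3 + Real.log B + b := by positivity
    rw [hγdef]
    nlinarith
  refine le_dimH_of_digitMeasure (by omega) hne hDB hD2 r (by linarith) _ ?_
  filter_upwards [ae_mem_digits hne, ae_dense_gaussMap_orbit hB hDB hD2 hγ hC]
    with ω hω hdense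
  refine ⟨?_, hdense⟩
  simpa only [natCast_zsmul] using havoid ω hω
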